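/- Let 𝒜 be a totally sign-skew-symmetric cluster algebra having principal coefficients, let t, t' ∈ 𝕋ₙ, and let α, β ∈ ℤⁿ be nonzero. If X_t^α = X_{t'}^β (equality of Laurent monomials in the respective clusters), then there is a permutation σ of [1,n] such that x_{i;t} = x_{σ(i);t'} and αᵢ = β_{σ(i)} for every i with αᵢ ≠ 0. -/

import Mathlib

/- Common framework for totally sign-skew-symmetric (TSSS) cluster algebras with
principal coefficients, following Fomin–Zelevinsky and the paper.

We realize the ambient field `ℱ` for a rank-`n` cluster algebra with principal
coefficients at the initial vertex `t₀` as the field of rational functions in the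
`2n` variables `x₁,…,xₙ,y₁,…,yₙ`.  Vertices of the `n`-regular tree `𝕋ₙ` are modelled
as paths (lists of mutation directions) starting from the initial vertex `t₀ = []`. -/

open scoped BigOperators Classical

namespace CA

/-- the positive part `[x]₊ = max(x,0)`. -/
def pp (x : ℤ) : ℤ := max x 0

/-- the modified binomial coefficient `C̃(i,j)`: the binomial coefficient `(i choose j)`
when `i ≥ 0`, and `0` when `i < 0`. -/
def ctilde (i : ℤ) (j : ℕ) : ℤ := if 0 ≤ i then (i.toNat.choose j : ℤ) else 0

/-- the (generalized) binomial coefficient `(i choose j) = i(i-1)⋯(i-j+1)/j!` for `i : ℤ`. -/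
def ibinom (i : ℤ) (j : ℕ) : ℤ :=
  if 0 ≤ i then (i.toNat.choose j : ℤ)
  else (-1 : ℤ) ^ j * ((((j : ℤ) - 1 - i).toNat.choose j : ℤ))

variable {n : ℕ}

/-- matrix mutation of a square `n × n` integer matrix in direction `k`. -/
def matMut (B : Matrix (Fin n) (Fin n) ℤ) (k : Fin n) : Matrix (Fin n) (Fin n) ℤ :=
  Matrix.of fun i j =>
    if i = k ∨ j = k then -B i j else B i j + (B i k).sign * pp (B i k * B k j)

/-- a square integer matrix is sign-skew-symmetric. -/
def SSS (B : Matrix (Fin n) (Fin n) ℤ) : Prop :=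
  ∀ i j, (B i j = 0 ∧ B j i = 0) ∨ B i j * B j i < 0

/-- a square integer matrix is totally sign-skew-symmetric: every iterated mutation of it
is sign-skew-symmetric. -/
def TSSS (B : Matrix (Fin n) (Fin n) ℤ) : Prop :=
  ∀ l : List (Fin n), SSS (l.foldl matMut B)

/-- `d` is a skew-symmetrizer of `B`, i.e. `diag(d) * B` is skew-symmetric with all `dᵢ > 0`;
this says `B` is skew-symmetrizable. -/
def SkewSymmetrizer (d : Fin n → ℤ) (B : Matrix (Fin n) (Fin n) ℤ) : Prop :=
  (∀ i, 0 < d i) ∧ ∀ i j, d i * B i j = -(d j * B j i)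

/-- the ambient field ℱ: rational functions in `x₁,…,xₙ` (indexed by `Sum.inl`) and
`y₁,…,yₙ` (indexed by `Sum.inr`). -/
abbrev K (n : ℕ) := FractionRing (MvPolynomial (Fin n ⊕ Fin n) ℚ)

noncomputable def gen (s : Fin n ⊕ Fin n) : K n :=
  algebraMap (MvPolynomial (Fin n ⊕ Fin n) ℚ) (K n) (MvPolynomial.X s)

/-- the initial cluster variables `x₁,…,xₙ`. -/
noncomputable def xv (i : Fin n) : K n := gen (Sum.inl i)

/-- the initial coefficients `y₁,…,yₙ` (generators of `ℙ = Trop(y₁,…,yₙ)`). -/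
noncomputable def yv (i : Fin n) : K n := gen (Sum.inr i)

/-- the extended `2n × n` exchange matrix `B̃ = (B ; I)` of the principal-coefficients seed. -/
def extB (B : Matrix (Fin n) (Fin n) ℤ) : Matrix (Fin n ⊕ Fin n) (Fin n) ℤ :=
  Matrix.of (Sum.elim B fun i j => if i = j then 1 else 0)

/-- mutation of an extended exchange matrix in direction `k`. -/
def extMut (Bt : Matrix (Fin n ⊕ Fin n) (Fin n) ℤ) (k : Fin n) :
    Matrix (Fin n ⊕ Fin n) (Fin n) ℤ :=
  Matrix.of fun i j =>
    if i = Sum.inl k ∨ j = k then -Bt i j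
    else Bt i j + (Bt i k).sign * pp (Bt i k * Bt (Sum.inl k) j)

/-- the extended exchange matrix at the vertex of `𝕋ₙ` reached from `t₀` along the path `t`. -/
def extBAt (B : Matrix (Fin n) (Fin n) ℤ) (t : List (Fin n)) :
    Matrix (Fin n ⊕ Fin n) (Fin n) ℤ :=
  t.foldl extMut (extB B)

/-- the (square) exchange matrix at the vertex `t`. -/
def sqBAt (B : Matrix (Fin n) (Fin n) ℤ) (t : List (Fin n)) : Matrix (Fin n) (Fin n) ℤ :=
  Matrix.of fun i j => extBAt B t (Sum.inl i) j

/-- a seed (of geometric type, with the frozen variables `y₁,…,yₙ` kept implicit):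
the cluster together with the extended exchange matrix. -/
structure Seed (n : ℕ) where
  x : Fin n → K n
  B : Matrix (Fin n ⊕ Fin n) (Fin n) ℤ

/-- seed mutation in direction `k` (principal coefficients / geometric type). -/
noncomputable def mutSeed (s : Seed n) (k : Fin n) : Seed n where
  x := Function.update s.x k
    (((∏ i, s.x i ^ pp (s.B (Sum.inl i) k)) * (∏ i, yv i ^ pp (s.B (Sum.inr i) k)) +
        (∏ i, s.x i ^ pp (-s.B (Sum.inl i) k)) * (∏ i, yv i ^ pp (-s.B (Sum.inr i) k))) /
      s.x k)
  B := extMut s.B k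

/-- the initial seed `Σ_{t₀}` of the cluster algebra with principal coefficients
with initial exchange matrix `B`. -/
noncomputable def initSeed (B : Matrix (Fin n) (Fin n) ℤ) : Seed n := ⟨xv, extB B⟩

/-- the seed `Σ_t` at the vertex of `𝕋ₙ` reached from `t₀` along the path `t`. -/
noncomputable def seed (B : Matrix (Fin n) (Fin n) ℤ) (t : List (Fin n)) : Seed n :=
  t.foldl mutSeed (initSeed B)

/-- the `Y`-variable `y_{j;t}` (a Laurent monomial in `y₁,…,yₙ` since `ℙ = Trop(Y)`). -/
noncomputable def yvarAt (B : Matrix (Fin n) (Fin n) ℤ) (t : List (Fin n)) (j : Fin n) :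
    K n :=
  ∏ i, yv i ^ extBAt B t (Sum.inr i) j

/-- `ŷ_j = y_j ∏ᵢ xᵢ^{b_{ij}}` at the initial vertex. -/
noncomputable def yhat (B : Matrix (Fin n) (Fin n) ℤ) (j : Fin n) : K n :=
  yv j * ∏ i, xv i ^ B i j

/-- auxiliary one-step recursion computing `g`-vectors along a path. -/
def gMut (B0 : Matrix (Fin n) (Fin n) ℤ)
    (st : Matrix (Fin n ⊕ Fin n) (Fin n) ℤ × (Fin n → Fin n → ℤ)) (k : Fin n) :
    Matrix (Fin n ⊕ Fin n) (Fin n) ℤ × (Fin n → Fin n → ℤ) :=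
  (extMut st.1 k, fun j d =>
    if j = k then
      -st.2 k d + (∑ i, pp (st.1 (Sum.inl i) k) * st.2 i d) -
        ∑ i, pp (st.1 (Sum.inr i) k) * B0 d i
    else st.2 j d)

/-- the `g`-vector `g_{l;t}` of the cluster variable `x_{l;t}` with respect to the initial
seed, via the standard recursion `g_{j;t₀} = e_j`,
`g_{k;t'} = -g_{k;t} + Σᵢ [bᵗ_{ik}]₊ g_{i;t} - Σᵢ [bᵗ_{n+i,k}]₊ b_i^{t₀}`. -/
def gvec (B : Matrix (Fin n) (Fin n) ℤ) (t : List (Fin n)) : Fin n → Fin n → ℤ :=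
  (t.foldl (gMut B) (extB B, fun j d => if d = j then 1 else 0)).2

/-- representations of Laurent polynomials `Σ c_e Y^{e∘inr} X_t^{e∘inl}` at a vertex `t`:
finitely supported integer coefficient functions on exponent vectors. -/
abbrev LP (n : ℕ) := ((Fin n ⊕ Fin n) → ℤ) →₀ ℤ

/-- evaluation of a Laurent-polynomial representation at the vertex `t`:
`e` contributes `c_e · Y_t^{e∘inr} · X_t^{e∘inl}`. -/
noncomputable def evalAt (B : Matrix (Fin n) (Fin n) ℤ) (t : List (Fin n)) (f : LP n) :
    K n :=
  f.sum fun e c =>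
    (c : K n) * (∏ i, yvarAt B t i ^ e (Sum.inr i)) * ∏ i, (seed B t).x i ^ e (Sum.inl i)

/-- the `ℤⁿ`-degree of the monomial with exponent vector `e` at the vertex `t`,
under the grading `deg(x_{i;t}) = eᵢ`, `deg(y_{i;t}) = -bᵢᵗ`. -/
def degVecAt (B : Matrix (Fin n) (Fin n) ℤ) (t : List (Fin n))
    (e : (Fin n ⊕ Fin n) → ℤ) : Fin n → ℤ :=
  fun j => e (Sum.inl j) - ∑ i, e (Sum.inr i) * sqBAt B t j i

/-- homogeneity of degree `h` of a Laurent polynomial at the vertex `t`. -/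
def HomogAt (B : Matrix (Fin n) (Fin n) ℤ) (t : List (Fin n)) (h : Fin n → ℤ)
    (f : LP n) : Prop :=
  ∀ e ∈ f.support, degVecAt B t e = h

/-- `g` is a summand of `f`: for every Laurent monomial, the coefficient in `g` lies
(weakly) between `0` and the coefficient in `f`. -/
def Summand (g f : LP n) : Prop :=
  ∀ e, (0 ≤ g e ∧ g e ≤ f e) ∨ (f e ≤ g e ∧ g e ≤ 0)

/-- the Laurent monomial `X^h` (with trivial coefficient) as a Laurent polynomial. -/
noncomputable def monX (h : Fin n → ℤ) : LP n := Finsupp.single (Sum.elim h 0) 1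

/-- `ℕℙ[X_t^{±1}]`, `ℙ = Trop(y₁,…,yₙ)`: the additive monoid generated by the
Laurent monomials `y^a X_t^b`, `a, b ∈ ℤⁿ`. -/
noncomputable def nnL (s : Seed n) : AddSubmonoid (K n) :=
  AddSubmonoid.closure {m | ∃ a b : Fin n → ℤ, m = (∏ i, yv i ^ a i) * ∏ i, s.x i ^ b i}

/-- `ℤℙ[X_t^{±1}]`: the additive group generated by the Laurent monomials `y^a X_t^b`. -/
noncomputable def zzL (s : Seed n) : AddSubgroup (K n) :=
  AddSubgroup.closure {m | ∃ a b : Fin n → ℤ, m = (∏ i, yv i ^ a i) * ∏ i, s.x i ^ b i}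

/-- `ℕ[Y_t][X_t^{±1}]`: the additive monoid generated by monomials `Y_t^a X_t^b`
with `a ∈ ℕⁿ`, `b ∈ ℤⁿ`. -/
noncomputable def nnYL (B : Matrix (Fin n) (Fin n) ℤ) (t : List (Fin n)) : AddSubmonoid (K n) :=
  AddSubmonoid.closure {m | ∃ (a : Fin n → ℕ) (b : Fin n → ℤ),
    m = (∏ j, yvarAt B t j ^ (a j : ℤ)) * ∏ i, (seed B t).x i ^ b i}

/-- `𝒰_{≥0}(Σ_t) = ℕℙ[X_t^{±1}] ∩ ⋂ᵢ ℕℙ[X_{tᵢ}^{±1}]`, `tᵢ` the neighbours of `t`. -/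
def UgeZero (B : Matrix (Fin n) (Fin n) ℤ) (t : List (Fin n)) : Set (K n) :=
  {v | v ∈ nnL (seed B t) ∧ ∀ k, v ∈ nnL (seed B (t ++ [k]))}

/-- the modification map `L^{t_k}` applied to a homogeneous element of degree `h`
at the vertex `t`: division by `y_{k;t}^{[-h_k]₊}`. -/
noncomputable def Lmap (B : Matrix (Fin n) (Fin n) ℤ) (t : List (Fin n)) (h : Fin n → ℤ)
    (k : Fin n) (v : K n) : K n :=
  v * yvarAt B t k ^ (-pp (-h k))

/-- `𝒰⁺(Σ_t)` for homogeneous elements of degree `h`. -/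
def UPlus (B : Matrix (Fin n) (Fin n) ℤ) (t : List (Fin n)) (h : Fin n → ℤ) :
    Set (K n) :=
  {v | v ∈ UgeZero B t ∧ v ∈ nnYL B t ∧ ∀ k, Lmap B t h k v ∈ nnYL B (t ++ [k])}

/-- `𝒰⁺_{≥0}(Σ_t) = 𝒰⁺(Σ_t) ∩ ⋂ᵢ 𝒰_{≥0}(Σ_{tᵢ})` for homogeneous elements of degree `h`. -/
def UPlusGeZero (B : Matrix (Fin n) (Fin n) ℤ) (t : List (Fin n)) (h : Fin n → ℤ) :
    Set (K n) :=
  {v | v ∈ UPlus B t h ∧ ∀ k, v ∈ UgeZero B (t ++ [k])}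

/-- `𝒰⁺_{≥0}(Σ_t)` (all homogeneous degrees together). -/
def UPGZ (B : Matrix (Fin n) (Fin n) ℤ) (t : List (Fin n)) : Set (K n) :=
  {v | ∃ h, v ∈ UPlusGeZero B t h}

/-- `v` is indecomposable in `S`: it is not a sum of two nonzero elements of `S`. -/
def IndecompIn (S : Set (K n)) (v : K n) : Prop :=
  ¬∃ a b, a ∈ S ∧ b ∈ S ∧ a ≠ 0 ∧ b ≠ 0 ∧ v = a + b

/-- `f` is (a Laurent-polynomial representation at the vertex `t` of) the element
`ρ_h^t`: an indecomposable element of `𝒰⁺_{≥0}(Σ_t)` (homogeneous of degree `h`,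
with nonnegative coefficients) having `X_t^h` as a summand. -/
def IsRhoAt (B : Matrix (Fin n) (Fin n) ℤ) (t : List (Fin n)) (h : Fin n → ℤ)
    (f : LP n) : Prop :=
  HomogAt B t h f ∧ (∀ e, 0 ≤ f e) ∧ Summand (monX h) f ∧
    evalAt B t f ∈ UPlusGeZero B t h ∧ IndecompIn (UPGZ B t) (evalAt B t f)

/-- the exponent vector (at `t₀`) of the Laurent monomial `Ŷ^p X^h`. -/
def hatExp (B : Matrix (Fin n) (Fin n) ℤ) (h p : Fin n → ℤ) : (Fin n ⊕ Fin n) → ℤ :=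
  Sum.elim (fun i => h i + ∑ j, B i j * p j) p

/-- the weight `co_p(N_h)`: the coefficient of `Ŷ^p X^h` in `ρ_h` (equivalently, of `Y^p`
in the `F`-polynomial). -/
def coeffN (B : Matrix (Fin n) (Fin n) ℤ) (h : Fin n → ℤ) (f : LP n) (p : Fin n → ℤ) :
    ℤ :=
  f (hatExp B h p)

def toR (p : Fin n → ℤ) : Fin n → ℝ := fun i => (p i : ℝ)

/-- the Newton polytope `N_h ⊆ ℝⁿ` of `ρ_h` (of the corresponding `F`-polynomial):
the convex hull of the support. -/
def NHull (B : Matrix (Fin n) (Fin n) ℤ) (h : Fin n → ℤ) (f : LP n) :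
    Set (Fin n → ℝ) :=
  convexHull ℝ (toR '' {p | coeffN B h f p ≠ 0})

/-- `S` is a face of the polytope `N`, i.e. the intersection of `N` with a hyperplane
given by a valid inequality. -/
def IsFaceOf (S N : Set (Fin n → ℝ)) : Prop :=
  ∃ (w : Fin n → ℝ) (cst : ℝ), (∀ q ∈ N, ∑ i, w i * q i ≤ cst) ∧
    S = N ∩ {q | ∑ i, w i * q i = cst}

/-- the dimension of a subset of `ℝⁿ` (of its affine hull). -/
noncomputable def dimOf (S : Set (Fin n → ℝ)) : ℕ :=
  Module.finrank ℝ (affineSpan ℝ S).direction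

noncomputable def finsetMinZ (s : Finset ℤ) : ℤ := if h : s.Nonempty then s.min' h else 0

/-- the denominator vector of a Laurent polynomial: `d_k = -min` of the `x_k`-exponents. -/
noncomputable def dvecOf (f : LP n) (k : Fin n) : ℤ :=
  -finsetMinZ (f.support.image fun e => e (Sum.inl k))

/-- `L^{t₀}` applied to (a representation at `t`) of `ρ_h^t`:
`F|_ℱ(Ŷ_t) X_t^h / F|_{Trop(Y_{t₀})}(Y_t)`, the tropical denominator being the
componentwise-minimal `y`-monomial of the support. -/
noncomputable def Lto (B : Matrix (Fin n) (Fin n) ℤ) (t : List (Fin n)) (f : LP n) :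
    K n :=
  evalAt B t f *
    (∏ i, yv i ^
      finsetMinZ (f.support.image fun e => ∑ j, e (Sum.inr j) * extBAt B t (Sum.inr i) j))⁻¹

/-- the set `𝒫 = {L^{t₀}(ρ_h^t) ∈ ℕℙ[X^{±1}] ∣ h ∈ ℤⁿ}` built from the vertex `t`. -/
def PSetAt (B : Matrix (Fin n) (Fin n) ℤ) (t : List (Fin n)) : Set (K n) :=
  {v | (∃ h f, IsRhoAt B t h f ∧ v = Lto B t f) ∧
    v ∈ nnL (seed B ([] : List (Fin n)))}

/-- universal positivity: lying in `ℕℙ[X_t^{±1}]` for every vertex `t`. -/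
def UnivPos (B : Matrix (Fin n) (Fin n) ℤ) (v : K n) : Prop :=
  ∀ t : List (Fin n), v ∈ nnL (seed B t)

/-- universal indecomposability. -/
def UnivIndecomp (B : Matrix (Fin n) (Fin n) ℤ) (v : K n) : Prop :=
  UnivPos B v ∧ ¬∃ a b, UnivPos B a ∧ UnivPos B b ∧ a ≠ 0 ∧ b ≠ 0 ∧ v = a + b

/-- `f` is the Laurent expansion of the cluster variable `x_{l;t}` in the initial cluster. -/
def IsExp (B : Matrix (Fin n) (Fin n) ℤ) (t : List (Fin n)) (l : Fin n) (f : LP n) :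
    Prop :=
  (seed B t).x l = evalAt B ([] : List (Fin n)) f

/-- the `F`-polynomial of a Laurent polynomial: set all `xᵢ = 1`,
i.e. push the coefficients to the `y`-exponents. -/
noncomputable def FPoly (f : LP n) : (Fin n → ℤ) →₀ ℤ :=
  Finsupp.mapDomain (fun e i => e (Sum.inr i)) f

/-- the cluster variable `x_{l;t}` is non-initial. -/
def NonInit (B : Matrix (Fin n) (Fin n) ℤ) (t : List (Fin n)) (l : Fin n) : Prop :=
  ∀ i, (seed B t).x l ≠ xv i

end CA
namespace CA
open AddMonoidAlgebra

/-! ### residue relation -/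
section res
variable {A F Q : Type*} [CommRing A] [Field F] [Field Q]

/-- `f` has residue `c`. -/
def Res (ψ : A →+* F) (Φ : A →+* Q) (f : F) (c : Q) : Prop :=
  ∃ a b, Φ b ≠ 0 ∧ f * ψ b = ψ a ∧ c * Φ b = Φ a

variable {ψ : A →+* F} {Φ : A →+* Q}

lemma Res.of (a : A) : Res ψ Φ (ψ a) (Φ a) := ⟨a, 1, by simp, by simp, by simp⟩

lemma Res.one : Res ψ Φ 1 1 := ⟨1, 1, by simp, by simp, by simp⟩

lemma Res.int (m : ℤ) : Res ψ Φ m m := ⟨m, 1, by simp, by simp, by simp⟩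

lemma Res.add {f g : F} {c d : Q} (h : Res ψ Φ f c) (k : Res ψ Φ g d) :
    Res ψ Φ (f + g) (c + d) := by
  obtain ⟨a, b, h1, h2, h3⟩ := h
  obtain ⟨a', b', k1, k2, k3⟩ := k
  refine ⟨a * b' + a' * b, b * b', by simp [h1, k1], ?_, ?_⟩
  · simp only [map_add, map_mul, ← h2, ← k2]; ring
  · simp only [map_add, map_mul, ← h3, ← k3]; ring

lemma Res.mul {f g : F} {c d : Q} (h : Res ψ Φ f c) (k : Res ψ Φ g d) :
    Res ψ Φ (f * g) (c * d) := by
  obtain ⟨a, b, h1, h2, h3⟩ := h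
  obtain ⟨a', b', k1, k2, k3⟩ := k
  refine ⟨a * a', b * b', by simp [h1, k1], ?_, ?_⟩
  · simp only [map_mul, ← h2, ← k2]; ring
  · simp only [map_mul, ← h3, ← k3]; ring

lemma Res.neg {f : F} {c : Q} (h : Res ψ Φ f c) : Res ψ Φ (-f) (-c) := by
  obtain ⟨a, b, h1, h2, h3⟩ := h
  exact ⟨-a, b, h1, by simp [← h2], by simp [← h3]⟩

lemma Res.pow {f : F} {c : Q} (h : Res ψ Φ f c) (m : ℕ) : Res ψ Φ (f ^ m) (c ^ m) := by
  induction m with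
  | zero => simpa using Res.one
  | succ m ih => simpa [pow_succ] using ih.mul h

lemma Res.inv (hψ : Function.Injective ψ) {f : F} {c : Q} (h : Res ψ Φ f c) (hc : c ≠ 0) :
    Res ψ Φ f⁻¹ c⁻¹ := by
  obtain ⟨a, b, h1, h2, h3⟩ := h
  have ha : Φ a ≠ 0 := by rw [← h3]; exact mul_ne_zero hc h1
  have ha' : ψ a ≠ 0 := by
    intro h; rw [map_eq_zero_iff ψ hψ] at h; simp [h] at ha
  have hf : f ≠ 0 := by rintro rfl; simp at h2; exact ha' h2.symm
  refine ⟨b, a, ha, ?_, ?_⟩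
  · rw [← h2]; field_simp
  · rw [← h3]; field_simp

lemma Res.unique (hψ : Function.Injective ψ) {f : F} {c d : Q} (h : Res ψ Φ f c)
    (k : Res ψ Φ f d) : c = d := by
  obtain ⟨a, b, h1, h2, h3⟩ := h
  obtain ⟨a', b', k1, k2, k3⟩ := k
  have e : a * b' = a' * b := by
    apply hψ
    simp only [map_mul, ← h2, ← k2]; ring
  have e2 := congrArg Φ e
  simp only [map_mul, ← h3, ← k3] at e2
  have : Φ b * Φ b' ≠ 0 := mul_ne_zero h1 k1
  apply mul_right_cancel₀ this
  linear_combination e2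

/-- nonzero residue -/
def Gd (ψ : A →+* F) (Φ : A →+* Q) (f : F) : Prop := ∃ c, c ≠ 0 ∧ Res ψ Φ f c

lemma Gd.one : Gd ψ Φ 1 := ⟨1, one_ne_zero, Res.one⟩

lemma Gd.mul {f g : F} (h : Gd ψ Φ f) (k : Gd ψ Φ g) : Gd ψ Φ (f * g) := by
  obtain ⟨c, hc, h⟩ := h
  obtain ⟨d, hd, k⟩ := k
  exact ⟨c * d, mul_ne_zero hc hd, h.mul k⟩

lemma Gd.inv (hψ : Function.Injective ψ) {f : F} (h : Gd ψ Φ f) : Gd ψ Φ f⁻¹ := by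
  obtain ⟨c, hc, h⟩ := h
  exact ⟨c⁻¹, inv_ne_zero hc, h.inv hψ hc⟩

lemma Gd.div (hψ : Function.Injective ψ) {f g : F} (h : Gd ψ Φ f) (k : Gd ψ Φ g) :
    Gd ψ Φ (f / g) := by
  rw [div_eq_mul_inv]; exact h.mul (k.inv hψ)

lemma Gd.pow {f : F} (h : Gd ψ Φ f) (m : ℕ) : Gd ψ Φ (f ^ m) := by
  obtain ⟨c, hc, h⟩ := h
  exact ⟨c ^ m, pow_ne_zero _ hc, h.pow m⟩

lemma Gd.zpow (hψ : Function.Injective ψ) {f : F} (h : Gd ψ Φ f) (m : ℤ) : Gd ψ Φ (f ^ m) := by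
  obtain ⟨k, rfl | rfl⟩ := m.eq_nat_or_neg
  · simpa using h.pow k
  · simpa using (h.pow k).inv hψ

lemma Gd.prod {ι : Type*} (s : Finset ι) (f : ι → F) (h : ∀ i ∈ s, Gd ψ Φ (f i)) :
    Gd ψ Φ (∏ i ∈ s, f i) :=
  Finset.prod_induction f (Gd ψ Φ) (fun _ _ => Gd.mul) Gd.one h

end res

/-! ### Laurent monomials -/
section mon
variable {ι : Type} [Fintype ι] {F : Type*} [Field F]

/-- Laurent monomial. -/
def mon (z : ι → F) (e : ι → ℤ) : F := ∏ i, z i ^ e i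

lemma mon_add (z : ι → F) (hz : ∀ i, z i ≠ 0) (e f : ι → ℤ) :
    mon z (e + f) = mon z e * mon z f := by
  simp only [mon, ← Finset.prod_mul_distrib]
  exact Finset.prod_congr rfl fun i _ => zpow_add₀ (hz i) _ _

lemma mon_zero (z : ι → F) : mon z 0 = 1 := by simp [mon]

lemma mon_ne (z : ι → F) (hz : ∀ i, z i ≠ 0) (e : ι → ℤ) : mon z e ≠ 0 :=
  Finset.prod_ne_zero_iff.mpr fun i _ => zpow_ne_zero _ (hz i)

lemma mon_neg (z : ι → F) (e : ι → ℤ) : mon z (-e) = (mon z e)⁻¹ := by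
  simp [mon, zpow_neg, Finset.prod_inv_distrib]

lemma mon_smul (z : ι → F) (m : ℤ) (e : ι → ℤ) : mon z (m • e) = mon z e ^ m := by
  simp only [mon, Pi.smul_apply, smul_eq_mul]
  rw [← Finset.prod_zpow]
  refine Finset.prod_congr rfl fun i _ => ?_
  rw [mul_comm, zpow_mul]

lemma mon_single [DecidableEq ι] (z : ι → F) (i : ι) (m : ℤ) : mon z (Pi.single i m) = z i ^ m := by
  rw [mon, Finset.prod_eq_single i]
  · simp
  · intro j _ hj; simp [hj]
  · simp

lemma mon_congr (z w : ι → F) (e : ι → ℤ) (h : ∀ i, e i ≠ 0 → z i = w i) : mon z e = mon w e := by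
  refine Finset.prod_congr rfl fun i _ => ?_
  by_cases he : e i = 0
  · simp [he]
  · rw [h i he]

/-- the Laurent ring hom attached to a tuple of nonzero elements -/
noncomputable def psi (z : ι → F) (hz : ∀ i, z i ≠ 0) : AddMonoidAlgebra ℤ (ι → ℤ) →+* F :=
  (AddMonoidAlgebra.lift ℤ F (ι → ℤ)
    { toFun := fun e => mon z e.toAdd
      map_one' := mon_zero z
      map_mul' := fun _ _ => mon_add z hz _ _ }).toRingHom

lemma psi_single (z : ι → F) (hz : ∀ i, z i ≠ 0) (e : ι → ℤ) (c : ℤ) :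
    psi z hz (single e c) = c * mon z e := by
  simp [psi]

/-- the Laurent ring as a subring -/
def Lz (z : ι → F) : Subring F := Subring.closure (Set.range z ∪ Set.range fun i => (z i)⁻¹)

lemma mem_Lz (z : ι → F) (i : ι) : z i ∈ Lz z := Subring.subset_closure (Or.inl ⟨i, rfl⟩)
lemma inv_mem_Lz (z : ι → F) (i : ι) : (z i)⁻¹ ∈ Lz z := Subring.subset_closure (Or.inr ⟨i, rfl⟩)

lemma zpow_mem_aux (S : Subring F) (x : F) (h : x ∈ S) (h' : x⁻¹ ∈ S) (m : ℤ) : x ^ m ∈ S := by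
  obtain ⟨k, rfl | rfl⟩ := m.eq_nat_or_neg
  · simpa using S.pow_mem h k
  · rw [zpow_neg, zpow_natCast, ← inv_pow]; exact S.pow_mem h' k

lemma mon_mem (z : ι → F) (e : ι → ℤ) : mon z e ∈ Lz z :=
  Subring.prod_mem _ fun i _ => zpow_mem_aux _ _ (mem_Lz z i) (inv_mem_Lz z i) _

lemma psi_mem (z : ι → F) (hz : ∀ i, z i ≠ 0) (f) : psi z hz f ∈ Lz z := by
  induction f using AddMonoidAlgebra.induction_linear with
  | zero => simp
  | add f g hf hg => rw [map_add]; exact Subring.add_mem _ hf hg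
  | single e c => 
    rw [psi_single]
    exact Subring.mul_mem _ (intCast_mem _ c) (mon_mem z e)

lemma exists_psi [DecidableEq ι] (z : ι → F) (hz : ∀ i, z i ≠ 0) (f : F) (hf : f ∈ Lz z) :
    ∃ a, psi z hz a = f := by
  have : Lz z ≤ (psi z hz).range := by
    refine Subring.closure_le.mpr ?_
    rintro _ (⟨i, rfl⟩ | ⟨i, rfl⟩)
    · exact ⟨single (Pi.single i 1) 1, by simp [psi_single, mon_single]⟩
    · exact ⟨single (Pi.single i (-1)) 1, by simp [psi_single, mon_single]⟩
  exact this hf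

lemma Lz_le (z : ι → F) (S : Subring F) (h : ∀ i, z i ∈ S) (h' : ∀ i, (z i)⁻¹ ∈ S) :
    Lz z ≤ S := by
  refine Subring.closure_le.mpr ?_
  rintro _ (⟨i, rfl⟩ | ⟨i, rfl⟩)
  · exact h i
  · exact h' i

/-- the residue map killing `1 + X^v` -/
noncomputable def PhiR (w : ι → F) (hw : ∀ i, w i ≠ 0) (v : ι → ℤ) (l : (ι → ℤ) →+ ℤ) :
    AddMonoidAlgebra ℤ (ι → ℤ) →+* F :=
  (AddMonoidAlgebra.lift ℤ F (ι → ℤ)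
    { toFun := fun e => mon w e.toAdd * (-(mon w v)) ^ (-l e.toAdd)
      map_one' := by simp [mon_zero]
      map_mul' := fun x y => by
        simp only [toAdd_mul, mon_add w hw, map_add, neg_add]
        rw [zpow_add₀ (neg_ne_zero.mpr (mon_ne w hw v))]
        ring }).toRingHom

variable (w : ι → F) (hw : ∀ i, w i ≠ 0) (v : ι → ℤ) (l : (ι → ℤ) →+ ℤ)

lemma PhiR_single (e : ι → ℤ) (c : ℤ) :
    PhiR w hw v l (single e c) = c * (mon w e * (-(mon w v)) ^ (-l e)) := by
  simp [PhiR]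

lemma PhiR_single_ne (e : ι → ℤ) : PhiR w hw v l (single e 1) ≠ 0 := by
  rw [PhiR_single]
  have := mon_ne w hw v
  have := mon_ne w hw e
  simp only [Int.cast_one, one_mul]
  exact mul_ne_zero this (zpow_ne_zero _ (by simpa))

lemma PhiR_single' (e : ι → ℤ) :
    ∃ s : ℤ, s ≠ 0 ∧ ∀ c, PhiR w hw v l (single e c) = psi w hw (single (e - l e • v) (s * c)) := by
  have hv := mon_ne w hw v
  rcases Int.even_or_odd (l e) with h | h
  · refine ⟨1, one_ne_zero, fun c => ?_⟩
    rw [PhiR_single, psi_single, sub_eq_add_neg, mon_add w hw, mon_neg, mon_smul, zpow_neg,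
      h.neg_zpow]; simp
  · refine ⟨-1, by simp, fun c => ?_⟩
    rw [PhiR_single, psi_single, sub_eq_add_neg, mon_add w hw, mon_neg, mon_smul, zpow_neg,
      h.neg_zpow]; simp

lemma dvd_aux (m : ℤ) : ∀ e : ι → ℤ, ∃ s : ℤ, (s : F) = (-1) ^ m ∧
    (single 0 1 + single v 1 : AddMonoidAlgebra ℤ (ι → ℤ)) ∣
      single e 1 - single (e - m • v) s := by
  induction m using Int.induction_on with
  | zero => intro e; exact ⟨1, by simp, by simp⟩
  | succ m ih =>
    intro e
    obtain ⟨s, hs, hd⟩ := ih e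
    refine ⟨-s, by rw [zpow_add₀ (by simp)]; simp [hs], ?_⟩
    have : (single e 1 - single (e - ((m:ℤ) + 1) • v) (-s) : AddMonoidAlgebra ℤ (ι → ℤ)) =
      (single e 1 - single (e - (m:ℤ) • v) s) +
        (single 0 1 + single v 1) * single (e - ((m:ℤ) + 1) • v) s := by
      rw [add_mul, single_mul_single, single_mul_single]
      have h1 : v + (e - ((m:ℤ) + 1) • v) = e - (m:ℤ) • v := by rw [add_smul]; simp; abel
      rw [h1, single_neg]; simp
    rw [this]
    exact dvd_add hd (dvd_mul_right _ _)
  | pred m ih =>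
    intro e
    obtain ⟨s, hs, hd⟩ := ih e
    refine ⟨-s, by rw [zpow_sub₀ (by simp)]; simp [hs, div_neg], ?_⟩
    have : (single e 1 - single (e - (-(m:ℤ) - 1) • v) (-s) : AddMonoidAlgebra ℤ (ι → ℤ)) =
      (single e 1 - single (e - (-(m:ℤ)) • v) s) +
        (single 0 1 + single v 1) * single (e - (-(m:ℤ)) • v) s := by
      rw [add_mul, single_mul_single, single_mul_single]
      have h1 : v + (e - (-(m:ℤ)) • v) = e - (-(m:ℤ) - 1) • v := by rw [sub_smul]; simp; abel
      rw [h1, single_neg, zero_add, one_mul]; abel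
    rw [this]
    exact dvd_add hd (dvd_mul_right _ _)

lemma PhiR_rep (f : AddMonoidAlgebra ℤ (ι → ℤ)) : ∃ g,
    (single 0 1 + single v 1 : AddMonoidAlgebra ℤ (ι → ℤ)) ∣ f - g ∧ psi w hw g = PhiR w hw v l f := by
  have hv := mon_ne w hw v
  induction f using AddMonoidAlgebra.induction_linear with
  | zero => exact ⟨0, by simp, by simp⟩
  | add f f' hf hf' =>
    obtain ⟨g, h1, h2⟩ := hf
    obtain ⟨g', h1', h2'⟩ := hf'
    refine ⟨g + g', ?_, by simp [h2, h2']⟩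
    rw [add_sub_add_comm]; exact dvd_add h1 h1'
  | single e c =>
    obtain ⟨s, hs, hd⟩ := dvd_aux (F := F) v (l e) e
    refine ⟨single (e - l e • v) (s * c), ?_, ?_⟩
    · have : (single e c - single (e - l e • v) (s * c) : AddMonoidAlgebra ℤ (ι → ℤ)) =
        (single e 1 - single (e - l e • v) s) * single 0 c := by
        rw [sub_mul, single_mul_single, single_mul_single]; simp
      rw [this]; exact hd.mul_right _
    · rw [PhiR_single, psi_single, sub_eq_add_neg, mon_add w hw, mon_neg, mon_smul, zpow_neg,
        neg_eq_neg_one_mul (mon w v), mul_zpow]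
      push_cast
      rw [hs]
      have : ((-1 : F) ^ l e)⁻¹ = (-1) ^ l e := by
        rw [← inv_zpow]; norm_num
      rw [mul_inv, this]; ring

lemma PhiR_ker (hinj : Function.Injective (psi w hw)) (f : AddMonoidAlgebra ℤ (ι → ℤ))
    (hf : PhiR w hw v l f = 0) : (single 0 1 + single v 1 : AddMonoidAlgebra ℤ (ι → ℤ)) ∣ f := by
  obtain ⟨g, h1, h2⟩ := PhiR_rep w hw v l f
  rw [hf, map_eq_zero_iff _ hinj] at h2
  simpa [h2] using h1

lemma PhiR_p (hl : l v = 1) : PhiR w hw v l (single 0 1 + single v 1) = 0 := by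
  have hv := mon_ne w hw v
  rw [map_add, PhiR_single, PhiR_single]
  simp [mon_zero, hl, zpow_neg]
  field_simp
  simp

end mon
end CA

namespace CA
open AddMonoidAlgebra

section mutsec
variable {n : ℕ} {F : Type*} [Field F]

abbrev I (n : ℕ) := Fin n ⊕ Fin n

/-- the mutated tuple -/
noncomputable def mutz (z : I n → F) (Bt : Matrix (I n) (Fin n) ℤ) (k : Fin n) : I n → F :=
  Function.update z (Sum.inl k)
    ((mon z (fun i => pp (Bt i k)) + mon z (fun i => pp (-Bt i k))) / z (Sum.inl k))

lemma mutz_ne (z : I n → F) (Bt : Matrix (I n) (Fin n) ℤ) (k : Fin n) (i : I n)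
    (h : i ≠ Sum.inl k) : mutz z Bt k i = z i := by
  simp [mutz, h]

lemma mutz_self (z : I n → F) (Bt : Matrix (I n) (Fin n) ℤ) (k : Fin n) :
    mutz z Bt k (Sum.inl k) =
    (mon z (fun i => pp (Bt i k)) + mon z (fun i => pp (-Bt i k))) / z (Sum.inl k) := by
  simp [mutz]

lemma pp_sub (x : ℤ) : pp x = pp (-x) + x := by
  unfold pp; omega

lemma P_eq (z : I n → F) (hz : ∀ i, z i ≠ 0) (Bt : Matrix (I n) (Fin n) ℤ) (k : Fin n) :
    mon z (fun i => pp (Bt i k)) + mon z (fun i => pp (-Bt i k)) =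
      mon z (fun i => pp (-Bt i k)) * (1 + mon z (fun i => Bt i k)) := by
  have : (fun i => pp (Bt i k)) = (fun i => pp (-Bt i k)) + (fun i => Bt i k) := by
    funext i; exact pp_sub _
  rw [this, mon_add z hz]; ring

lemma mutz_neg (z : I n → F) (Bt : Matrix (I n) (Fin n) ℤ) (k : Fin n) :
    mutz z (-Bt) k = mutz z Bt k := by
  simp [mutz, add_comm]

lemma extMut_neg (Bt : Matrix (I n) (Fin n) ℤ) (k : Fin n) :
    extMut (-Bt) k = -extMut Bt k := by
  ext i j
  simp only [extMut, Matrix.of_apply, Matrix.neg_apply]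
  split_ifs <;> simp [Int.sign_neg]; ring

/-- functional from a row -/
def lin (d : I n → ℤ) : (I n → ℤ) →+ ℤ where
  toFun e := ∑ i, d i * e i
  map_zero' := by simp
  map_add' x y := by simp [mul_add, Finset.sum_add_distrib]

variable (z : I n → F) (hz : ∀ i, z i ≠ 0) (Bt : Matrix (I n) (Fin n) ℤ) (j : Fin n)
  (hjj : Bt (Sum.inl j) j = 0) (l : (I n → ℤ) →+ ℤ) (hl : l (fun i => Bt i j) = 1)
  (hw : ∀ i, mutz z Bt j i ≠ 0) (hinj : Function.Injective (psi (mutz z Bt j) hw))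

/-- shorthand: residue map at the mutated seed -/
noncomputable abbrev Ph : AddMonoidAlgebra ℤ (I n → ℤ) →+* F :=
  PhiR (mutz z Bt j) hw (fun i => Bt i j) l

lemma mon_mutz (e : I n → ℤ) (he : e (Sum.inl j) = 0) : mon (mutz z Bt j) e = mon z e := by
  apply mon_congr
  intro i hi
  apply mutz_ne
  rintro rfl
  exact hi he

lemma res_mon (e : I n → ℤ) (he : e (Sum.inl j) = 0) :
    Res (psi (mutz z Bt j) hw) (Ph z Bt j l hw) (mon z e) (Ph z Bt j l hw (single e 1)) := by
  have := Res.of (ψ := psi (mutz z Bt j) hw) (Φ := Ph z Bt j l hw) (single e 1)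
  rwa [psi_single, mon_mutz _ _ _ _ he, Int.cast_one, one_mul] at this

lemma gd_mon (e : I n → ℤ) (he : e (Sum.inl j) = 0) :
    Gd (psi (mutz z Bt j) hw) (Ph z Bt j l hw) (mon z e) :=
  ⟨_, PhiR_single_ne _ _ _ _ _, res_mon z Bt j l hw e he⟩

lemma gd_z (i : I n) (hi : i ≠ Sum.inl j) :
    Gd (psi (mutz z Bt j) hw) (Ph z Bt j l hw) (z i) := by
  have := gd_mon z Bt j l hw (Pi.single i 1) (by simp [hi.symm])
  simpa [mon_single] using this

lemma res_w : Res (psi (mutz z Bt j) hw) (Ph z Bt j l hw) (mutz z Bt j (Sum.inl j))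
    (Ph z Bt j l hw (single (Pi.single (Sum.inl j) 1) 1)) := by
  have := Res.of (ψ := psi (mutz z Bt j) hw) (Φ := Ph z Bt j l hw)
    (single (Pi.single (Sum.inl j) 1) 1)
  rwa [psi_single, mon_single, Int.cast_one, one_mul, zpow_one] at this

lemma gd_w : Gd (psi (mutz z Bt j) hw) (Ph z Bt j l hw) (mutz z Bt j (Sum.inl j)) :=
  ⟨_, PhiR_single_ne _ _ _ _ _, res_w z Bt j l hw⟩

include hz hjj in
lemma w_mul_z : mutz z Bt j (Sum.inl j) * z (Sum.inl j) =
    mon z (fun i => pp (-Bt i j)) * (1 + mon z (fun i => Bt i j)) := by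
  rw [mutz_self, P_eq z hz]
  have := hz (Sum.inl j)
  field_simp

include hjj hl in
lemma Ph_yhat : Ph z Bt j l hw (single (fun i => Bt i j) 1) = -1 := by
  have := PhiR_p (mutz z Bt j) hw (fun i => Bt i j) l hl
  rw [map_add] at this
  have h2 : PhiR (mutz z Bt j) hw (fun i => Bt i j) l (single 0 1) = 1 := by
    simp [PhiR_single, mon_zero]
  rw [h2] at this
  exact (neg_eq_of_add_eq_zero_right this).symm

include hz hjj hl hinj in
lemma res_z : Res (psi (mutz z Bt j) hw) (Ph z Bt j l hw) (z (Sum.inl j)) 0 := by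
  have h1 : z (Sum.inl j) = mon z (fun i => pp (-Bt i j)) * (1 + mon z (fun i => Bt i j)) *
      (mutz z Bt j (Sum.inl j))⁻¹ := by
    rw [← w_mul_z z hz Bt j hjj]
    have := hw (Sum.inl j)
    field_simp
  rw [h1]
  have h2 := (res_mon z Bt j l hw (fun i => Bt i j) hjj)
  rw [Ph_yhat z Bt j hjj l hl hw] at h2
  have h3 := (res_mon z Bt j l hw (fun i => pp (-Bt i j)) (by simp [hjj, pp])).mul
    (Res.one.add h2)
  have h4 := h3.mul ((res_w z Bt j l hw).inv hinj (PhiR_single_ne _ _ _ _ _))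
  simpa using h4

include hz hinj in
lemma gd_u_zero (a : Fin n) (haj : a ≠ j) (hja : Bt (Sum.inl j) a = 0)
    (hla : l (fun i => Bt i a) = 0) :
    Gd (psi (mutz z Bt j) hw) (Ph z Bt j l hw) (mutz z Bt a (Sum.inl a)) := by
  rw [mutz_self, P_eq z hz]
  refine Gd.div hinj (Gd.mul (gd_mon z Bt j l hw _ (by simp [hja, pp])) ?_)
    (gd_z z Bt j l hw _ (by simpa using haj))
  refine ⟨_, ?_, Res.one.add (res_mon z Bt j l hw _ hja)⟩
  have : (1 : F) + Ph z Bt j l hw (single (fun i => Bt i a) 1) =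
      psi (mutz z Bt j) hw (single 0 1 + single (fun i => Bt i a) 1) := by
    rw [PhiR_single, hla, map_add, psi_single, psi_single]; simp [mon_zero]
  rw [this, Ne, map_eq_zero_iff _ hinj]
  intro h
  have h0 := congrArg (fun f : AddMonoidAlgebra ℤ (I n → ℤ) => f.coeff 0) h
  simp [Finsupp.single_apply] at h0
  split_ifs at h0 <;> omega

include hz hjj hl hinj in
lemma gd_u_pos (a : Fin n) (haj : a ≠ j) (hja : 0 < Bt (Sum.inl j) a) :
    Gd (psi (mutz z Bt j) hw) (Ph z Bt j l hw) (mutz z Bt a (Sum.inl a)) ∧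
    ∃ (c : ℕ) (m : I n → ℤ), m (Sum.inl j) = 0 ∧
      mon z (fun i => Bt i a) = z (Sum.inl j) ^ (c + 1) * mon z m := by
  have key : ∃ (c : ℕ) (m : I n → ℤ), m (Sum.inl j) = 0 ∧
      mon z (fun i => Bt i a) = z (Sum.inl j) ^ (c + 1) * mon z m := by
    refine ⟨(Bt (Sum.inl j) a - 1).toNat,
      (fun i => Bt i a) - Pi.single (Sum.inl j) (Bt (Sum.inl j) a), by simp, ?_⟩
    have h1 : z (Sum.inl j) ^ ((Bt (Sum.inl j) a - 1).toNat + 1) =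
        mon z (Pi.single (Sum.inl j) (Bt (Sum.inl j) a)) := by
      rw [mon_single, ← zpow_natCast]
      congr 1
      push_cast
      rw [Int.toNat_of_nonneg (by omega)]; ring
    rw [h1, ← mon_add z hz]; congr 1; abel
  refine ⟨?_, key⟩
  obtain ⟨c, m, hm, hcm⟩ := key
  rw [mutz_self, P_eq z hz]
  refine Gd.div hinj (Gd.mul (gd_mon z Bt j l hw _ ?_) ?_)
    (gd_z z Bt j l hw _ (by simpa using haj))
  · simp [pp]; omega
  · rw [hcm]
    refine ⟨1, one_ne_zero, ?_⟩
    have := Res.one.add (((res_z z hz Bt j hjj l hl hw hinj).pow (c+1)).mul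
      (res_mon z Bt j l hw m hm))
    simpa using this

include hinj in
lemma nonvan (m m' : I n → ℤ) (hm : m (Sum.inl j) = 1) (hm' : m' (Sum.inl j) = 0) (β : ℤ)
    (hjj : Bt (Sum.inl j) j = 0) :
    Ph z Bt j l hw (single m 1) - Ph z Bt j l hw (single m' β) ≠ 0 := by
  obtain ⟨s, hs, h⟩ := PhiR_single' (mutz z Bt j) hw (fun i => Bt i j) l m
  obtain ⟨s', -, h'⟩ := PhiR_single' (mutz z Bt j) hw (fun i => Bt i j) l m'
  rw [h, h', ← map_sub, Ne, map_eq_zero_iff _ hinj]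
  intro h
  have h0 := congrArg (fun f : AddMonoidAlgebra ℤ (I n → ℤ) => f.coeff (m - l m • (fun i => Bt i j))) h
  have hne : m' - l m' • (fun i => Bt i j) ≠ m - l m • (fun i => Bt i j) := by
    intro h
    have := congrFun h (Sum.inl j)
    simp [hm, hm', hjj] at this
  generalize m' - l m' • (fun i => Bt i j) = p at h0 hne
  generalize m - l m • (fun i => Bt i j) = q at h0 hne
  simp [Finsupp.single_apply, hne] at h0
  exact hs h0

end mutsec
end CA

namespace CA
open AddMonoidAlgebra

section loc
variable {n : ℕ} {F : Type*} [Field F]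

lemma extMut_entry (Bt : Matrix (I n) (Fin n) ℤ) (a j : Fin n) (haj : a ≠ j)
    (hb : Bt (Sum.inl a) j < 0) (i : I n) (hi : i ≠ Sum.inl a) :
    extMut Bt a i j = Bt i j + Bt (Sum.inl a) j * pp (-Bt i a) := by
  simp only [extMut, Matrix.of_apply, hi, haj.symm, or_self, if_false]
  congr 1
  rcases lt_trichotomy (Bt i a) 0 with h | h | h
  · have h1 : 0 < Bt i a * Bt (Sum.inl a) j := mul_pos_of_neg_of_neg h hb
    rw [Int.sign_eq_neg_one_of_neg h]
    simp only [pp]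
    rw [max_eq_left h1.le, max_eq_left (by omega)]; ring
  · simp [h, pp]
  · have h1 : Bt i a * Bt (Sum.inl a) j < 0 := mul_neg_of_pos_of_neg h hb
    simp only [pp]
    rw [max_eq_right h1.le, max_eq_right (by omega)]; simp

lemma extMut_row (Bt : Matrix (I n) (Fin n) ℤ) (a j : Fin n) :
    extMut Bt a (Sum.inl a) j = - Bt (Sum.inl a) j := by
  simp [extMut]

lemma yhat_mut (z : I n → F) (hz : ∀ i, z i ≠ 0) (Bt : Matrix (I n) (Fin n) ℤ) (a j : Fin n)
    (haj : a ≠ j) (haa : Bt (Sum.inl a) a = 0) (b : ℕ) (hb : Bt (Sum.inl a) j = -b) (hb0 : 0 < b)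
    (hz1 : ∀ i, mutz z Bt a i ≠ 0) :
    mon (mutz z Bt a) (fun i => extMut Bt a i j) =
      mon z (fun i => Bt i j) * (1 + mon z (fun i => Bt i a)) ^ b := by
  have hbneg : Bt (Sum.inl a) j < 0 := by omega
  have e1 : (fun i => extMut Bt a i j) =
      ((fun i => Bt i j) + (-(b:ℤ)) • (fun i => pp (-Bt i a)) + Pi.single (Sum.inl a) (b:ℤ)) +
        Pi.single (Sum.inl a) (b:ℤ) := by
    funext i
    by_cases hi : i = Sum.inl a
    · subst hi
      simp [extMut_row, hb, haa, pp]
    · rw [extMut_entry Bt a j haj hbneg i hi, hb]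
      simp [hi]
  rw [e1, mon_add _ hz1, mon_single, mon_mutz, mon_add _ hz, mon_add _ hz, mon_smul, mon_single,
    mutz_self, P_eq z hz]
  · have h1 := hz (Sum.inl a)
    have h2 := mon_ne z hz (fun i => pp (-Bt i a))
    simp only [zpow_neg, zpow_natCast, div_pow, mul_pow]
    field_simp
  · simp [hb, haa, pp]

variable (z : I n → F) (hz : ∀ i, z i ≠ 0) (Bt : Matrix (I n) (Fin n) ℤ) (j : Fin n)
  (hjj : Bt (Sum.inl j) j = 0) (l : (I n → ℤ) →+ ℤ) (hl : l (fun i => Bt i j) = 1)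
  (hw : ∀ i, mutz z Bt j i ≠ 0) (hinj : Function.Injective (psi (mutz z Bt j) hw))

lemma Res.geom {A F Q : Type*} [CommRing A] [Field F] [Field Q] {ψ : A →+* F} {Φ : A →+* Q}
    {x M : F} {μ : Q} (hx : x ≠ 0) (h : Res ψ Φ x 0) (hM : Res ψ Φ M μ) (c b : ℕ) :
    Res ψ Φ (((1 + x ^ (c+1) * M) ^ b - 1) / x) (b * (0 ^ c * μ)) := by
  induction b with
  | zero => simpa using Res.int 0
  | succ b ih =>
    have h1 := (h.pow (c+1)).mul hM
    have h2 := (h.pow c).mul hM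
    have h3 := ((Res.one.add h1).mul ih).add h2
    convert h3 using 1
    · field_simp; ring
    · simp; ring

include hz hjj hl hinj in
lemma gd_xpp_pos (a : Fin n) (haj : a ≠ j) (haa : Bt (Sum.inl a) a = 0)
    (hja : 0 < Bt (Sum.inl j) a) (hab : Bt (Sum.inl a) j < 0)
    (hz1 : ∀ i, mutz z Bt a i ≠ 0) :
    Gd (psi (mutz z Bt j) hw) (Ph z Bt j l hw)
      (mutz (mutz z Bt a) (extMut Bt a) j (Sum.inl j)) := by
  obtain ⟨b, hb⟩ : ∃ b : ℕ, Bt (Sum.inl a) j = -b := ⟨(-Bt (Sum.inl a) j).toNat, by omega⟩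
  obtain ⟨-, c, m, hm, hcm⟩ := gd_u_pos z hz Bt j hjj l hl hw hinj a haj hja
  have hjB : extMut Bt a (Sum.inl j) j = 0 := by
    rw [extMut_entry Bt a j haj hab _ (by simpa using haj.symm), hjj]
    have : pp (-Bt (Sum.inl j) a) = 0 := by simp only [pp]; omega
    simp [this]
  have hzj := hz (Sum.inl j)
  rw [mutz_self, P_eq _ hz1, yhat_mut z hz Bt a j haj haa b hb (by omega) hz1,
    mon_mutz _ _ _ _ (by simp only [extMut_row, pp]; omega),
    mutz_ne _ _ _ _ (by simpa using haj.symm), mul_div_assoc]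
  refine Gd.mul (gd_mon z Bt j l hw _ (by simp [hjB, pp])) ?_
  have hmj := mon_ne z hz (fun i => pp (-Bt i j))
  have e : (1 + mon z (fun i => Bt i j) * (1 + mon z (fun i => Bt i a)) ^ b) / z (Sum.inl j) =
      mutz z Bt j (Sum.inl j) * (mon z (fun i => pp (-Bt i j)))⁻¹ +
      mon z (fun i => Bt i j) * (((1 + mon z (fun i => Bt i a)) ^ b - 1) / z (Sum.inl j)) := by
    have := w_mul_z z hz Bt j hjj
    field_simp
    linear_combination -this
  have hpj : pp (-Bt (Sum.inl j) j) = 0 := by simp [hjj, pp]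
  have r1 := (res_w z Bt j l hw).mul
    ((res_mon z Bt j l hw (fun i => pp (-Bt i j)) hpj).inv hinj
      (PhiR_single_ne _ _ _ _ _))
  have r2 := (res_mon z Bt j l hw (fun i => Bt i j) hjj).mul
    (Res.geom hzj (res_z z hz Bt j hjj l hl hw hinj) (res_mon z Bt j l hw m hm) c b)
  rw [Ph_yhat z Bt j hjj l hl hw] at r2
  rw [e, hcm]
  refine ⟨_, ?_, r1.add r2⟩
  have nv := nonvan z Bt j l hw hinj (Pi.single (Sum.inl j) 1) (m + fun i => pp (-Bt i j))
    (by simp) (by simp [hm, hpj]) (b * 0 ^ c) hjj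
  have hs : (single (m + fun i => pp (-Bt i j)) ((b:ℤ) * 0 ^ c) : AddMonoidAlgebra ℤ (I n → ℤ)) =
      single 0 ((b:ℤ) * 0 ^ c) * (single m 1 * single (fun i => pp (-Bt i j)) 1) := by
    rw [single_mul_single, single_mul_single]; simp
  have h0 : Ph z Bt j l hw (single 0 ((b:ℤ) * 0 ^ c)) = b * 0 ^ c := by
    rw [PhiR_single]; simp [mon_zero]
  have hn := PhiR_single_ne (mutz z Bt j) hw (fun i => Bt i j) l (fun i => pp (-Bt i j))
  rw [hs, map_mul, map_mul, h0] at nv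
  intro h
  apply nv
  field_simp at h
  linear_combination h

/-- the elements with a residue form a subring -/
def ResRing {A F Q : Type*} [CommRing A] [Field F] [Field Q] (ψ : A →+* F) (Φ : A →+* Q) :
    Subring F where
  carrier := {f | ∃ c, Res ψ Φ f c}
  mul_mem' := fun ⟨c, h⟩ ⟨d, k⟩ => ⟨c * d, h.mul k⟩
  one_mem' := ⟨1, Res.one⟩
  add_mem' := fun ⟨c, h⟩ ⟨d, k⟩ => ⟨c + d, h.add k⟩
  zero_mem' := ⟨0, by simpa using Res.int (ψ := ψ) (Φ := Φ) 0⟩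
  neg_mem' := fun ⟨c, h⟩ => ⟨-c, h.neg⟩

lemma Lz_le_ResRing {ι : Type} [Fintype ι] {A F Q : Type*} [CommRing A] [Field F] [Field Q] {ψ : A →+* F} {Φ : A →+* Q}
    (hψ : Function.Injective ψ) (z : ι → F) (h : ∀ i, Gd ψ Φ (z i)) : Lz z ≤ ResRing ψ Φ := by
  refine Subring.closure_le.mpr ?_
  rintro _ (⟨i, rfl⟩ | ⟨i, rfl⟩)
  · obtain ⟨c, -, hc⟩ := h i; exact ⟨c, hc⟩
  · obtain ⟨c, -, hc⟩ := (h i).inv hψ; exact ⟨c, hc⟩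

include hz hjj hl hinj in
/-- all generators of the doubly mutated ring have nonzero residue -/
lemma gd_all (a : Fin n) (haj : a ≠ j) (haa : Bt (Sum.inl a) a = 0)
    (hs : (Bt (Sum.inl a) j = 0 ∧ Bt (Sum.inl j) a = 0) ∨
      (0 < Bt (Sum.inl j) a ∧ Bt (Sum.inl a) j < 0))
    (hla : l (fun i => Bt i a) = 0)
    (hz1 : ∀ i, mutz z Bt a i ≠ 0) (i : I n) :
    Gd (psi (mutz z Bt j) hw) (Ph z Bt j l hw) (mutz (mutz z Bt a) (extMut Bt a) j i) := by
  by_cases hij : i = Sum.inl j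
  · subst hij
    rcases hs with ⟨h1, h2⟩ | ⟨h1, h2⟩
    · have hcol : ∀ i, extMut Bt a i j = Bt i j := by
        intro i
        simp only [extMut, Matrix.of_apply, haj.symm, or_false]
        split_ifs with h
        · subst h; simp [h1]
        · simp [h1, pp]
      have : mutz (mutz z Bt a) (extMut Bt a) j (Sum.inl j) = mutz z Bt j (Sum.inl j) := by
        rw [mutz_self, mutz_self]
        simp only [hcol]
        rw [mon_mutz _ _ _ _ (by simp [h1, pp]), mon_mutz _ _ _ _ (by simp [h1, pp]),
          mutz_ne _ _ _ _ (by simpa using haj.symm)]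
      rw [this]; exact gd_w z Bt j l hw
    · exact gd_xpp_pos z hz Bt j hjj l hl hw hinj a haj haa h1 h2 hz1
  · rw [mutz_ne _ _ _ _ hij]
    by_cases hia : i = Sum.inl a
    · subst hia
      rcases hs with ⟨h1, h2⟩ | ⟨h1, h2⟩
      · exact gd_u_zero z hz Bt j l hw hinj a haj h2 hla
      · exact (gd_u_pos z hz Bt j hjj l hl hw hinj a haj h1).1
    · rw [mutz_ne _ _ _ _ hia]; exact gd_z z Bt j l hw i hij

/-- the exchange binomial as Laurent polynomial at the mutated seed -/
noncomputable def pol (Bt : Matrix (I n) (Fin n) ℤ) (j : Fin n) : AddMonoidAlgebra ℤ (I n → ℤ) :=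
  single (fun i => pp (-Bt i j)) 1 * (single 0 1 + single (fun i => Bt i j) 1)

include hz hjj in
lemma psi_pol : psi (mutz z Bt j) hw (pol Bt j) = mutz z Bt j (Sum.inl j) * z (Sum.inl j) := by
  rw [w_mul_z z hz Bt j hjj, pol, map_mul, map_add, psi_single, psi_single, psi_single,
    mon_mutz _ _ _ _ (by simp [hjj, pp]), mon_mutz _ _ _ (fun i => Bt i j) hjj, mon_mutz _ _ _ 0 rfl]
  simp [mon_zero]

lemma pol_dvd (f : AddMonoidAlgebra ℤ (I n → ℤ))
    (h : (single 0 1 + single (fun i => Bt i j) 1 : AddMonoidAlgebra ℤ (I n → ℤ)) ∣ f) :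
    pol Bt j ∣ f := by
  obtain ⟨g, rfl⟩ := h
  refine ⟨single (fun i => -pp (-Bt i j)) 1 * g, ?_⟩
  have : (single (fun i => pp (-Bt i j)) 1 * single (fun i => -pp (-Bt i j)) 1 :
      AddMonoidAlgebra ℤ (I n → ℤ)) = 1 := by
    rw [single_mul_single]
    have : (fun i => pp (-Bt i j)) + (fun i => -pp (-Bt i j)) = 0 := by funext i; simp
    rw [this]; rfl
  rw [pol]
  linear_combination (-(single 0 1 + single (fun i => Bt i j) 1) * g) * this

include hinj in
lemma pol_dvd_of_Ph (f : AddMonoidAlgebra ℤ (I n → ℤ)) (h : Ph z Bt j l hw f = 0) :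
    pol Bt j ∣ f :=
  pol_dvd _ _ _ (PhiR_ker _ _ _ _ hinj _ h)

include hl in
lemma Ph_pol : Ph z Bt j l hw (pol Bt j) = 0 := by
  rw [pol, map_mul, PhiR_p _ _ _ _ hl, mul_zero]

include hz hjj in
/-- elements of the unmutated ring have denominators powers of `pol` -/
lemma denom (f : F) (hf : f ∈ Lz z) :
    ∃ (N : ℕ) (g : AddMonoidAlgebra ℤ (I n → ℤ)),
      f * psi (mutz z Bt j) hw (pol Bt j) ^ N = psi (mutz z Bt j) hw g := by
  have hz' : ∀ i, i ≠ Sum.inl j → ∃ g, z i = psi (mutz z Bt j) hw g := by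
    intro i hi
    refine ⟨single (Pi.single i 1) 1, ?_⟩
    rw [psi_single, mon_single, mutz_ne _ _ _ _ hi]; simp
  have hz'' : ∀ i, i ≠ Sum.inl j → ∃ g, (z i)⁻¹ = psi (mutz z Bt j) hw g := by
    intro i hi
    refine ⟨single (Pi.single i (-1)) 1, ?_⟩
    rw [psi_single, mon_single, mutz_ne _ _ _ _ hi]; simp
  have hp := psi_pol z hz Bt j hjj hw
  have hwj := hw (Sum.inl j)
  have hzj := hz (Sum.inl j)
  have hwg : mutz z Bt j (Sum.inl j) = psi (mutz z Bt j) hw (single (Pi.single (Sum.inl j) 1) 1) := by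
    rw [psi_single, mon_single]; simp
  have hwg' : (mutz z Bt j (Sum.inl j))⁻¹ =
      psi (mutz z Bt j) hw (single (Pi.single (Sum.inl j) (-1)) 1) := by
    rw [psi_single, mon_single]; simp
  induction hf using Subring.closure_induction with
  | mem x hx =>
    rcases hx with ⟨i, rfl⟩ | ⟨i, rfl⟩
    · by_cases hi : i = Sum.inl j
      · subst hi
        refine ⟨0, pol Bt j * single (Pi.single (Sum.inl j) (-1)) 1, ?_⟩
        rw [map_mul, ← hwg', hp]; field_simp
      · obtain ⟨g, hg⟩ := hz' i hi; exact ⟨0, g, by simpa using hg⟩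
    · by_cases hi : i = Sum.inl j
      · subst hi
        refine ⟨1, single (Pi.single (Sum.inl j) 1) 1, ?_⟩
        rw [← hwg, hp]; field_simp
      · obtain ⟨g, hg⟩ := hz'' i hi; exact ⟨0, g, by simpa using hg⟩
  | zero => exact ⟨0, 0, by simp⟩
  | one => exact ⟨0, 1, by simp⟩
  | add x y _ _ hx hy =>
    obtain ⟨N, g, h⟩ := hx
    obtain ⟨N', g', h'⟩ := hy
    refine ⟨N + N', g * pol Bt j ^ N' + g' * pol Bt j ^ N, ?_⟩
    simp only [map_add, map_mul, map_pow, ← h, ← h']; ring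
  | neg x _ hx =>
    obtain ⟨N, g, h⟩ := hx
    exact ⟨N, -g, by simp [← h]⟩
  | mul x y _ _ hx hy =>
    obtain ⟨N, g, h⟩ := hx
    obtain ⟨N', g', h'⟩ := hy
    refine ⟨N + N', g * g', ?_⟩
    simp only [map_mul, ← h, ← h']; ring

include hz hjj hl hinj in
lemma mem_of_res (f : F) (hf : f ∈ Lz z) (c : F)
    (hc : Res (psi (mutz z Bt j) hw) (Ph z Bt j l hw) f c) : f ∈ Lz (mutz z Bt j) := by
  obtain ⟨N, g, h⟩ := denom z hz Bt j hjj hw f hf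
  have hp0 : psi (mutz z Bt j) hw (pol Bt j) ≠ 0 := by
    rw [psi_pol z hz Bt j hjj hw]; exact mul_ne_zero (hw _) (hz _)
  induction N generalizing g with
  | zero => rw [pow_zero, mul_one] at h; rw [h]; exact psi_mem _ _ _
  | succ N ih =>
    obtain ⟨a, b, h1, h2, h3⟩ := hc
    have e : g * b = a * pol Bt j ^ (N + 1) := by
      apply hinj
      rw [map_mul, map_mul, map_pow, ← h, ← h2]; ring
    have e2 := congrArg (Ph z Bt j l hw) e
    rw [map_mul, map_mul, map_pow, Ph_pol z Bt j l hl hw, zero_pow (by omega), mul_zero] at e2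
    have hg0 : Ph z Bt j l hw g = 0 := (mul_eq_zero.mp e2).resolve_right h1
    obtain ⟨g', rfl⟩ := pol_dvd_of_Ph z Bt j l hw hinj g hg0
    apply ih g'
    apply mul_right_cancel₀ hp0
    rw [map_mul] at h
    rw [mul_assoc, ← pow_succ, h]; ring

include hz hjj hinj in
/-- the local lemma -/
lemma local_lemma (a : Fin n) (haj : a ≠ j) (haa : Bt (Sum.inl a) a = 0)
    (hs : (Bt (Sum.inl a) j = 0 ∧ Bt (Sum.inl j) a = 0) ∨
      Bt (Sum.inl a) j * Bt (Sum.inl j) a < 0)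
    (d : I n → ℤ) (hd : ∑ i, d i * Bt i j = 1) (hda : ∑ i, d i * Bt i a = 0)
    (hz1 : ∀ i, mutz z Bt a i ≠ 0) (f : F) (hf : f ∈ Lz z)
    (hf' : f ∈ Lz (mutz (mutz z Bt a) (extMut Bt a) j)) : f ∈ Lz (mutz z Bt j) := by
  have main : ∀ (Bt : Matrix (I n) (Fin n) ℤ) (_ : Bt (Sum.inl j) j = 0)
      (hw : ∀ i, mutz z Bt j i ≠ 0) (_ : Function.Injective (psi (mutz z Bt j) hw))
      (_ : Bt (Sum.inl a) a = 0)
      (_ : (Bt (Sum.inl a) j = 0 ∧ Bt (Sum.inl j) a = 0) ∨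
        (0 < Bt (Sum.inl j) a ∧ Bt (Sum.inl a) j < 0))
      (d : I n → ℤ) (_ : ∑ i, d i * Bt i j = 1) (_ : ∑ i, d i * Bt i a = 0)
      (_ : ∀ i, mutz z Bt a i ≠ 0)
      (_ : f ∈ Lz (mutz (mutz z Bt a) (extMut Bt a) j)), f ∈ Lz (mutz z Bt j) := by
    intro Bt hjj hw hinj haa hs d hd hda hz1 hf'
    obtain ⟨c, hc⟩ := Lz_le_ResRing hinj _
      (gd_all z hz Bt j hjj (lin d) hd hw hinj a haj haa hs hda hz1) hf'
    exact mem_of_res z hz Bt j hjj (lin d) hd hw hinj f hf c hc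
  rcases hs with h | h
  · exact main Bt hjj hw hinj haa (Or.inl h) d hd hda hz1 hf'
  · rcases mul_neg_iff.mp h with ⟨h1, h2⟩ | ⟨h1, h2⟩
    · have := main (-Bt) (by simp [hjj]) (by simpa [mutz_neg] using hw)
        (by simpa [mutz_neg] using hinj) (by simp [haa]) (Or.inr (by simp; omega)) (-d)
        (by simpa using hd) (by simpa using hda) (by simpa [mutz_neg] using hz1)
        (by simpa [mutz_neg, extMut_neg] using hf')
      simpa [mutz_neg] using this
    · exact main Bt hjj hw hinj haa (Or.inr ⟨h2, h1⟩) d hd hda hz1 hf'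

end loc
end CA

namespace CA
open AddMonoidAlgebra

section seedfacts
variable {n : ℕ}

/-- the extended cluster -/
noncomputable def zt (B : Matrix (Fin n) (Fin n) ℤ) (t : List (Fin n)) : I n → K n :=
  Sum.elim (seed B t).x yv

lemma seed_append (B : Matrix (Fin n) (Fin n) ℤ) (t : List (Fin n)) (k : Fin n) :
    seed B (t ++ [k]) = mutSeed (seed B t) k := by
  simp [seed]

lemma zt_append (B : Matrix (Fin n) (Fin n) ℤ) (t : List (Fin n)) (k : Fin n) :
    zt B (t ++ [k]) = mutz (zt B t) (seed B t).B k := by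
  funext i
  rw [zt, seed_append]
  rcases i with i | i
  · by_cases h : i = k
    · subst h
      rw [mutz_self]
      simp [mutSeed, mon, zt, Fintype.prod_sum_type]
    · rw [mutz_ne _ _ _ _ (by simpa using h)]
      simp [mutSeed, zt, h]
  · rw [mutz_ne _ _ _ _ (by simp)]
    simp [zt]

lemma B_append (B : Matrix (Fin n) (Fin n) ℤ) (t : List (Fin n)) (k : Fin n) :
    (seed B (t ++ [k])).B = extMut (seed B t).B k := by
  rw [seed_append]; rfl

lemma top_eq (B : Matrix (Fin n) (Fin n) ℤ) (t : List (Fin n)) (i j : Fin n) :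
    (seed B t).B (Sum.inl i) j = t.foldl matMut B i j := by
  induction t using List.reverseRecOn generalizing i j with
  | nil => rfl
  | append_singleton t k ih =>
    rw [B_append, List.foldl_append]
    simp [extMut, matMut, ih]

lemma sss (B : Matrix (Fin n) (Fin n) ℤ) (hB : TSSS B) (t : List (Fin n)) (i j : Fin n) :
    ((seed B t).B (Sum.inl i) j = 0 ∧ (seed B t).B (Sum.inl j) i = 0) ∨
      (seed B t).B (Sum.inl i) j * (seed B t).B (Sum.inl j) i < 0 := by
  rw [top_eq, top_eq]; exact hB t i j

lemma diag0 (B : Matrix (Fin n) (Fin n) ℤ) (hB : TSSS B) (t : List (Fin n)) (i : Fin n) :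
    (seed B t).B (Sum.inl i) i = 0 := by
  rcases sss B hB t i i with h | h
  · exact h.1
  · nlinarith

lemma extMut_extMut (Bt : Matrix (I n) (Fin n) ℤ) (k : Fin n) :
    extMut (extMut Bt k) k = Bt := by
  ext i j
  by_cases hi : i = Sum.inl k
  · subst hi; simp [extMut]
  by_cases hj : j = k
  · subst hj; simp [extMut]
  simp [extMut, hi, hj]

lemma mutz_mutz {F : Type*} [Field F] (z : I n → F) (hz : ∀ i, z i ≠ 0)
    (Bt : Matrix (I n) (Fin n) ℤ) (k : Fin n) (hk : Bt (Sum.inl k) k = 0)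
    (hw : mutz z Bt k (Sum.inl k) ≠ 0) :
    mutz (mutz z Bt k) (extMut Bt k) k = z := by
  funext i
  by_cases hi : i = Sum.inl k
  · subst hi
    rw [mutz_self]
    have hcol : ∀ i, extMut Bt k i k = - Bt i k := by intro i; simp [extMut]
    simp only [hcol, neg_neg]
    rw [mon_mutz _ _ _ _ (by simp [hk, pp]), mon_mutz _ _ _ _ (by simp [hk, pp])]
    rw [div_eq_iff hw, mutz_self]
    have := hz (Sum.inl k)
    field_simp
    ring
  · rw [mutz_ne _ _ _ _ hi, mutz_ne _ _ _ _ hi]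

/-! left inverses -/
lemma left_inv_mut (Bt : Matrix (I n) (Fin n) ℤ) (k : Fin n) (hk : Bt (Sum.inl k) k = 0)
    (D : Matrix (Fin n) (I n) ℤ) (hD : D * Bt = 1) :
    ∃ D' : Matrix (Fin n) (I n) ℤ, D' * extMut Bt k = 1 := by
  let e : I n → ℤ := fun i => if i = Sum.inl k then -2 else pp (-Bt i k)
  let f : Fin n → ℤ := fun j => if j = k then -2 else pp (Bt (Sum.inl k) j)
  let E : Matrix (I n) (I n) ℤ := 1 + Matrix.vecMulVec e (Pi.single (Sum.inl k : I n) (1:ℤ))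
  let G : Matrix (Fin n) (Fin n) ℤ := 1 + Matrix.vecMulVec (Pi.single k (1:ℤ)) f
  have hE : E * E = 1 := by
    have : Matrix.vecMulVec e (Pi.single (Sum.inl k : I n) (1:ℤ)) * Matrix.vecMulVec e (Pi.single (Sum.inl k : I n) (1:ℤ))
        = (-2 : ℤ) • Matrix.vecMulVec e (Pi.single (Sum.inl k : I n) (1:ℤ)) := by
      rw [Matrix.vecMulVec_mul_vecMulVec]
      ext i j
      simp [Matrix.vecMulVec_apply, e]
      split_ifs <;> ring
    simp only [E, mul_add, add_mul, mul_one, one_mul, this]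
    module
  have hG : G * G = 1 := by
    have : Matrix.vecMulVec (Pi.single k (1:ℤ)) f * Matrix.vecMulVec (Pi.single k (1:ℤ)) f
        = (-2 : ℤ) • Matrix.vecMulVec (Pi.single k (1:ℤ)) f := by
      rw [Matrix.vecMulVec_mul_vecMulVec]
      ext i j
      simp [Matrix.vecMulVec_apply, f]
      split_ifs <;> ring
    simp only [G, mul_add, add_mul, mul_one, one_mul, this]
    module
  have hM : extMut Bt k = E * Bt * G := by
    have h1 : E * Bt * G = Matrix.of fun i j =>
        Bt i j + e i * Bt (Sum.inl k) j + Bt i k * f j := by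
      ext i j
      simp [E, G, add_mul, mul_add, Matrix.mul_apply, Matrix.vecMulVec_apply, Pi.single_apply,
        Matrix.add_apply, Finset.sum_add_distrib, hk, Matrix.one_apply]
    rw [h1]
    ext i j
    by_cases hi : i = Sum.inl k
    · subst hi
      simp [extMut, e, hk]; ring
    by_cases hj : j = k
    · subst hj
      simp [extMut, f, hk]; ring
    simp only [extMut, hi, hj, e, f, Matrix.of_apply, or_self, if_false]
    generalize Bt i k = x
    generalize Bt (Sum.inl k) j = y
    generalize Bt i j = w
    simp only [pp]
    rcases lt_trichotomy x 0 with hx | hx | hx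
    · rw [Int.sign_eq_neg_one_of_neg hx, max_eq_left (by omega : (0:ℤ) ≤ -x)]
      rcases le_total y 0 with hy | hy
      · rw [max_eq_right hy, max_eq_left (mul_nonneg_of_nonpos_of_nonpos hx.le hy)]; ring
      · rw [max_eq_left hy, max_eq_right (mul_nonpos_of_nonpos_of_nonneg hx.le hy)]; ring
    · subst hx; simp
    · rw [Int.sign_eq_one_of_pos hx, max_eq_right (by omega : -x ≤ (0:ℤ))]
      rcases le_total y 0 with hy | hy
      · rw [max_eq_right hy, max_eq_right (mul_nonpos_of_nonneg_of_nonpos hx.le hy)]; ring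
      · rw [max_eq_left hy, max_eq_left (mul_nonneg hx.le hy)]; ring
  refine ⟨G * D * E, ?_⟩
  rw [hM]
  calc G * D * E * (E * Bt * G) = G * (D * ((E * E) * Bt)) * G := by simp only [Matrix.mul_assoc]
    _ = 1 := by rw [hE, Matrix.one_mul, hD, Matrix.mul_one, hG]

lemma left_inv (B : Matrix (Fin n) (Fin n) ℤ) (hB : TSSS B) (t : List (Fin n)) :
    ∃ D : Matrix (Fin n) (I n) ℤ, D * (seed B t).B = 1 := by
  induction t using List.reverseRecOn with
  | nil =>
    refine ⟨Matrix.of fun j => Sum.elim 0 (Pi.single j 1), ?_⟩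
    ext i j
    have h1 : ∀ i j, (seed B []).B (Sum.inr i) j = if i = j then 1 else 0 := fun _ _ => rfl
    simp [Matrix.mul_apply, h1, Pi.single_apply, Matrix.one_apply]
  | append_singleton t k ih =>
    obtain ⟨D, hD⟩ := ih
    rw [B_append]
    exact left_inv_mut _ k (diag0 B hB t k) D hD

lemma left_inv' (B : Matrix (Fin n) (Fin n) ℤ) (hB : TSSS B) (t : List (Fin n)) (j : Fin n) :
    ∃ d : I n → ℤ, ∑ i, d i * (seed B t).B i j = 1 ∧
      ∀ a, a ≠ j → ∑ i, d i * (seed B t).B i a = 0 := by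
  obtain ⟨D, hD⟩ := left_inv B hB t
  refine ⟨D j, ?_, fun a ha => ?_⟩
  · have := congrFun (congrFun hD j) j
    simpa [Matrix.mul_apply] using this
  · have := congrFun (congrFun hD j) a
    simpa [Matrix.mul_apply, Matrix.one_apply, ha.symm] using this

end seedfacts

/-! ### evaluation points and positivity -/
section pos
variable {n : ℕ}

/-- evaluation point -/
noncomputable def pt (i : Fin n) : I n → ℚ := fun s => if s = Sum.inr i then 0 else 1

/-- residue relation at the evaluation point -/
abbrev RP (i : Fin n) (f : K n) (c : ℚ) : Prop :=
  Res (algebraMap (MvPolynomial (I n) ℚ) (K n)) (MvPolynomial.eval (pt i)) f c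

lemma RP_gen (i : Fin n) (s : I n) : RP i (gen s) (pt i s) := by
  have := Res.of (ψ := algebraMap (MvPolynomial (I n) ℚ) (K n)) (Φ := MvPolynomial.eval (pt i))
    (MvPolynomial.X s)
  rw [MvPolynomial.eval_X] at this
  exact this

lemma alg_inj : Function.Injective (algebraMap (MvPolynomial (I n) ℚ) (K n)) :=
  IsFractionRing.injective _ _

lemma RP_prod_pos {ι : Type*} (i : Fin n) (s : Finset ι) (f : ι → K n)
    (h : ∀ k ∈ s, ∃ c, 0 < c ∧ RP i (f k) c) : ∃ c, 0 < c ∧ RP i (∏ k ∈ s, f k) c :=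
  Finset.prod_induction f (fun f => ∃ c, 0 < c ∧ RP i f c)
    (fun _ _ ⟨c, hc, h⟩ ⟨d, hd, k⟩ => ⟨c * d, mul_pos hc hd, h.mul k⟩) ⟨1, one_pos, Res.one⟩ h

lemma RP_prod_nn {ι : Type*} (i : Fin n) (s : Finset ι) (f : ι → K n)
    (h : ∀ k ∈ s, ∃ c, 0 ≤ c ∧ RP i (f k) c) : ∃ c, 0 ≤ c ∧ RP i (∏ k ∈ s, f k) c :=
  Finset.prod_induction f (fun f => ∃ c, 0 ≤ c ∧ RP i f c)
    (fun _ _ ⟨c, hc, h⟩ ⟨d, hd, k⟩ => ⟨c * d, mul_nonneg hc hd, h.mul k⟩)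
    ⟨1, zero_le_one, Res.one⟩ h

lemma pp_nat (x : ℤ) : pp x = (x.toNat : ℤ) := by simp [pp]

lemma RP_mon_nn (i : Fin n) (z : I n → K n) (hz : ∀ s, ∃ c, 0 ≤ c ∧ RP i (z s) c) (e : I n → ℤ) :
    ∃ c, 0 ≤ c ∧ RP i (mon z (fun s => pp (e s))) c := by
  refine RP_prod_nn i _ _ fun s _ => ?_
  obtain ⟨c, hc, h⟩ := hz s
  beta_reduce
  rw [pp_nat, zpow_natCast]
  exact ⟨_, pow_nonneg hc _, h.pow _⟩

lemma RP_mon_pos (i : Fin n) (z : I n → K n)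
    (hz : ∀ s, s ≠ Sum.inr i → ∃ c, 0 < c ∧ RP i (z s) c) (e : I n → ℤ) (he : e (Sum.inr i) ≤ 0) :
    ∃ c, 0 < c ∧ RP i (mon z (fun s => pp (e s))) c := by
  refine RP_prod_pos i _ _ fun s _ => ?_
  by_cases hs : s = Sum.inr i
  · subst hs
    have : pp (e (Sum.inr i)) = 0 := by simp [pp, he]
    beta_reduce
    rw [this]
    exact ⟨1, one_pos, by simpa using Res.one⟩
  obtain ⟨c, hc, h⟩ := hz s hs
  beta_reduce
  rw [pp_nat, zpow_natCast]
  exact ⟨_, pow_pos hc _, h.pow _⟩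

lemma zt_pos (B : Matrix (Fin n) (Fin n) ℤ) (t : List (Fin n)) (i : Fin n) :
    ∀ s, s ≠ Sum.inr i → ∃ c, 0 < c ∧ RP i (zt B t s) c := by
  induction t using List.reverseRecOn with
  | nil =>
    intro s hs
    have : zt B [] s = gen s := by rcases s with s | s <;> rfl
    rw [this]
    have h := RP_gen i s
    exact ⟨_, by simp [pt, hs], h⟩
  | append_singleton t k ih =>
    intro s hs
    rw [zt_append]
    by_cases hk : s = Sum.inl k
    · subst hk
      rw [mutz_self]
      obtain ⟨c, hc, h⟩ := ih _ hs
      have hnn : ∀ s, ∃ c, 0 ≤ c ∧ RP i (zt B t s) c := by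
        intro s
        by_cases hs : s = Sum.inr i
        · subst hs
          exact ⟨_, le_of_eq (by simp [pt]), RP_gen i (Sum.inr i)⟩
        · obtain ⟨c, hc, h⟩ := ih s hs
          exact ⟨c, hc.le, h⟩
      have hP : ∃ d, 0 < d ∧ RP i (mon (zt B t) (fun i => pp ((seed B t).B i k)) +
          mon (zt B t) (fun i => pp (-(seed B t).B i k))) d := by
        rcases le_total ((seed B t).B (Sum.inr i) k) 0 with h0 | h0
        · obtain ⟨c, hc, h⟩ := RP_mon_pos i _ ih (fun i => (seed B t).B i k) h0
          obtain ⟨d, hd, h'⟩ := RP_mon_nn i _ hnn (fun i => -(seed B t).B i k)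
          exact ⟨c + d, by positivity, h.add h'⟩
        · obtain ⟨c, hc, h⟩ := RP_mon_pos i _ ih (fun i => -(seed B t).B i k) (by simpa using h0)
          obtain ⟨d, hd, h'⟩ := RP_mon_nn i _ hnn (fun i => (seed B t).B i k)
          exact ⟨d + c, by positivity, h'.add h⟩
      obtain ⟨d, hd, h'⟩ := hP
      rw [div_eq_mul_inv]
      exact ⟨d * c⁻¹, by positivity, h'.mul (h.inv alg_inj hc.ne')⟩
    · rw [mutz_ne _ _ _ _ hk]
      exact ih s hs

lemma gen_ne (s : I n) : gen s ≠ (0 : K n) := by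
  rw [gen, Ne, map_eq_zero_iff _ alg_inj]
  exact MvPolynomial.X_ne_zero s

lemma zt_ne (B : Matrix (Fin n) (Fin n) ℤ) (t : List (Fin n)) (s : I n) : zt B t s ≠ 0 := by
  rcases s with j | j
  · obtain ⟨c, hc, h⟩ := zt_pos B t j (Sum.inl j) (by simp)
    intro h0
    rw [h0] at h
    have : RP j (0 : K n) 0 := by simpa using Res.int (ψ := algebraMap (MvPolynomial (I n) ℚ) (K n)) (Φ := MvPolynomial.eval (pt j)) 0
    exact hc.ne' (h.unique alg_inj this)
  · exact gen_ne _

end pos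

/-! ### algebraic independence -/
section algind
variable {n : ℕ}

lemma psi_inj {ι : Type} [Fintype ι] {F : Type*} [Field F] [Algebra ℚ F] (z : ι → F)
    (hz : ∀ i, z i ≠ 0) (h : AlgebraicIndependent ℚ z) : Function.Injective (psi z hz) := by
  have : CharZero F := algebraRat.charZero F
  rw [injective_iff_map_eq_zero]
  intro g hg
  let E : ι → ℤ := fun i => ∑ e ∈ g.coeff.support, |e i|
  have hE : ∀ e ∈ g.coeff.support, ∀ i, 0 ≤ e i + E i := by
    intro e he i
    have : |e i| ≤ E i := Finset.single_le_sum (f := fun e : ι → ℤ => |e i|) (fun _ _ => abs_nonneg _) he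
    have := neg_abs_le (e i)
    omega
  let τ : (ι → ℤ) → (ι →₀ ℕ) := fun e => Finsupp.equivFunOnFinite.symm fun i => (e i + E i).toNat
  let p : MvPolynomial ι ℚ := ∑ e ∈ g.coeff.support, MvPolynomial.monomial (τ e) (g.coeff e : ℚ)
  have hp : MvPolynomial.aeval z p = mon z E * psi z hz g := by
    have hg' : g = ∑ e ∈ g.coeff.support, single e (g.coeff e) := by
      conv_lhs => rw [← AddMonoidAlgebra.sum_coeff_single g]
      rfl
    conv_rhs => rw [hg']
    simp only [p, map_sum, psi_single, Finset.mul_sum]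
    refine Finset.sum_congr rfl fun e he => ?_
    rw [MvPolynomial.aeval_monomial]
    have : (τ e).prod (fun i k => z i ^ k) = mon z (e + E) := by
      rw [Finsupp.prod_fintype _ _ (by simp), mon]
      refine Finset.prod_congr rfl fun i _ => ?_
      rw [← zpow_natCast]
      congr 1
      simp only [τ, Finsupp.equivFunOnFinite_symm_apply_apply, Pi.add_apply]
      exact Int.toNat_of_nonneg (hE e he i)
    rw [this, mon_add z hz]
    simp; ring
  rw [hg, mul_zero] at hp
  have hp0 : p = 0 := (algebraicIndependent_iff.mp h) p hp
  ext e
  by_contra hne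
  have he : e ∈ g.coeff.support := by simpa using hne
  have hc := congrArg (MvPolynomial.coeff (τ e)) hp0
  simp only [p, MvPolynomial.coeff_sum, MvPolynomial.coeff_monomial, MvPolynomial.coeff_zero] at hc
  rw [Finset.sum_eq_single e] at hc
  · simp at hc; simp [hc] at hne
  · intro e' he' hee
    rw [if_neg]
    intro hτ
    apply hee
    funext i
    have := DFunLike.congr_fun hτ i
    simp only [τ, Finsupp.equivFunOnFinite_symm_apply_apply] at this
    have h1 := hE e he i
    have h2 := hE e' he' i
    omega
  · intro h; exact absurd he h

lemma mem_adj {F : Type*} [Field F] [Algebra ℚ F] (S : IntermediateField ℚ F) (z : I n → F)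
    (h : ∀ i, z i ∈ S) (e : I n → ℤ) : mon z e ∈ S :=
  prod_mem fun i _ => zpow_mem (h i) _

lemma adj_top (B : Matrix (Fin n) (Fin n) ℤ) (hB : TSSS B) (t : List (Fin n)) :
    IntermediateField.adjoin ℚ (Set.range (zt B t)) = ⊤ := by
  induction t using List.reverseRecOn with
  | nil =>
    rw [eq_top_iff]
    intro x _
    have hg : ∀ s, gen s ∈ IntermediateField.adjoin ℚ (Set.range (zt B [])) := by
      intro s
      apply IntermediateField.subset_adjoin
      refine ⟨s, ?_⟩
      rcases s with s | s <;> rfl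
    have hp : ∀ p : MvPolynomial (I n) ℚ, algebraMap _ (K n) p ∈
        IntermediateField.adjoin ℚ (Set.range (zt B [])) := by
      intro p
      induction p using MvPolynomial.induction_on with
      | C a =>
        have : algebraMap (MvPolynomial (I n) ℚ) (K n) (MvPolynomial.C a) = algebraMap ℚ (K n) a := by
          rw [IsScalarTower.algebraMap_apply ℚ (MvPolynomial (I n) ℚ) (K n)]; rfl
        rw [this]
        exact IntermediateField.algebraMap_mem _ a
      | add p q hp hq => rw [map_add]; exact add_mem hp hq
      | mul_X p s hp => rw [map_mul]; exact mul_mem hp (hg s)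
    obtain ⟨p, q, hq, rfl⟩ := IsFractionRing.div_surjective (A := MvPolynomial (I n) ℚ) x
    exact div_mem (hp p) (hp q)
  | append_singleton t k ih =>
    rw [eq_top_iff, ← ih, IntermediateField.adjoin_le_iff]
    rintro _ ⟨s, rfl⟩
    set S := IntermediateField.adjoin ℚ (Set.range (zt B (t ++ [k]))) with hS
    have hw : ∀ i, zt B (t ++ [k]) i ∈ S := fun i => IntermediateField.subset_adjoin _ _ ⟨i, rfl⟩
    by_cases hs : s = Sum.inl k
    · subst hs
      have hz := zt_ne B t
      have hwn := zt_ne B (t ++ [k])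
      rw [zt_append] at hw hwn
      have h1 := mutz_self (zt B t) (seed B t).B k
      have hkk := diag0 B hB t k
      have h2 := mem_adj S _ hw (fun i => pp ((seed B t).B i k))
      have h3 := mem_adj S _ hw (fun i => pp (-(seed B t).B i k))
      rw [mon_mutz _ _ _ _ (by simp [hkk, pp])] at h2 h3
      have : zt B t (Sum.inl k) = (mon (zt B t) (fun i => pp ((seed B t).B i k)) +
          mon (zt B t) (fun i => pp (-(seed B t).B i k))) /
          mutz (zt B t) (seed B t).B k (Sum.inl k) := by
        rw [eq_div_iff (hwn _), h1]
        have := hz (Sum.inl k)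
        field_simp
      rw [this]
      exact div_mem (add_mem h2 h3) (hw _)
    · have := hw s
      rw [zt_append, mutz_ne _ _ _ _ hs] at this
      exact this

lemma zt_algind (B : Matrix (Fin n) (Fin n) ℤ) (hB : TSSS B) (t : List (Fin n)) :
    AlgebraicIndependent ℚ (zt B t) := by
  have halg : Algebra.IsAlgebraic (Algebra.adjoin ℚ (Set.range (zt B t))) (K n) := by
    constructor
    intro x
    have hx : x ∈ IntermediateField.adjoin ℚ (Set.range (zt B t)) := by
      rw [adj_top B hB t]; trivial
    induction hx using IntermediateField.adjoin_induction with
    | mem x hx =>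
      exact isAlgebraic_algebraMap (⟨x, Algebra.subset_adjoin hx⟩ : Algebra.adjoin ℚ (Set.range (zt B t)))
    | algebraMap x =>
      exact isAlgebraic_algebraMap (algebraMap ℚ (Algebra.adjoin ℚ (Set.range (zt B t))) x)
    | add x y _ _ hx hy => exact hx.add hy
    | inv x _ hx => exact hx.inv
    | mul x y _ _ hx hy => exact hx.mul hy
  have hgen : AlgebraicIndependent ℚ (fun s : I n => (gen s : K n)) := by
    rw [algebraicIndependent_iff]
    intro p hp
    have : MvPolynomial.aeval (fun s : I n => (gen s : K n)) p =
        algebraMap (MvPolynomial (I n) ℚ) (K n) p := by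
      have h2 : MvPolynomial.aeval (fun s : I n => (gen s : K n)) =
          IsScalarTower.toAlgHom ℚ (MvPolynomial (I n) ℚ) (K n) := by
        ext s; simp [gen]
      rw [h2]; rfl
    rw [this, map_eq_zero_iff _ alg_inj] at hp
    exact hp
  exact (Algebra.IsAlgebraic.isTranscendenceBasis_of_le_trdeg_of_finite ℚ (zt B t)
    hgen.cardinalMk_le_trdeg).1

lemma zt_inj (B : Matrix (Fin n) (Fin n) ℤ) (hB : TSSS B) (t : List (Fin n)) :
    Function.Injective (psi (zt B t) (zt_ne B t)) :=
  psi_inj _ _ (zt_algind B hB t)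

end algind
end CA

namespace CA
open AddMonoidAlgebra

section upper
variable {n : ℕ}

/-- the local upper bound -/
noncomputable def Ut (B : Matrix (Fin n) (Fin n) ℤ) (t : List (Fin n)) : Subring (K n) :=
  Lz (zt B t) ⊓ ⨅ k, Lz (zt B (t ++ [k]))

lemma mem_Ut (B : Matrix (Fin n) (Fin n) ℤ) (t : List (Fin n)) (f : K n) :
    f ∈ Ut B t ↔ f ∈ Lz (zt B t) ∧ ∀ k, f ∈ Lz (zt B (t ++ [k])) := by
  simp [Ut, Subring.mem_inf, Subring.mem_iInf]

lemma zt_invol (B : Matrix (Fin n) (Fin n) ℤ) (hB : TSSS B) (t : List (Fin n)) (a : Fin n) :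
    zt B (t ++ [a] ++ [a]) = zt B t := by
  have h := zt_ne B (t ++ [a]) (Sum.inl a)
  rw [zt_append] at h
  rw [zt_append, zt_append, B_append, mutz_mutz _ (zt_ne B t) _ _ (diag0 B hB t a) h]

lemma B_invol (B : Matrix (Fin n) (Fin n) ℤ) (t : List (Fin n)) (a : Fin n) :
    (seed B (t ++ [a] ++ [a])).B = (seed B t).B := by
  rw [B_append, B_append, extMut_extMut]

lemma zt_invol' (B : Matrix (Fin n) (Fin n) ℤ) (hB : TSSS B) (t : List (Fin n)) (a j : Fin n) :
    zt B (t ++ [a] ++ [a] ++ [j]) = zt B (t ++ [j]) := by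
  rw [zt_append, zt_invol B hB, B_invol, zt_append]

lemma Ut_step (B : Matrix (Fin n) (Fin n) ℤ) (hB : TSSS B) (t : List (Fin n)) (a : Fin n) :
    Ut B t ≤ Ut B (t ++ [a]) := by
  intro f hf
  rw [mem_Ut] at hf ⊢
  refine ⟨hf.2 a, fun j => ?_⟩
  by_cases haj : a = j
  · subst haj; rw [zt_invol B hB]; exact hf.1
  obtain ⟨d, hd, hda⟩ := left_inv' B hB (t ++ [a]) j
  have hw := zt_ne B (t ++ [a] ++ [j])
  have hinj := zt_inj B hB (t ++ [a] ++ [j])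
  have hz1 := zt_ne B (t ++ [a] ++ [a])
  have h2 := hf.2 j
  rw [← zt_invol' B hB t a j, zt_append, B_append, zt_append B (t ++ [a])] at h2
  have := local_lemma (zt B (t ++ [a])) (zt_ne B _) (seed B (t ++ [a])).B j (diag0 B hB _ j)
    (by rw [← zt_append]; exact hw) (by simpa only [← zt_append] using hinj)
    a haj (diag0 B hB _ a) (sss B hB _ a j) d hd (hda a haj) (by rw [← zt_append]; exact hz1)
    f (hf.2 a) h2
  rwa [← zt_append] at this

lemma Ut_step_eq (B : Matrix (Fin n) (Fin n) ℤ) (hB : TSSS B) (t : List (Fin n)) (a : Fin n) :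
    Ut B (t ++ [a]) = Ut B t := by
  apply le_antisymm _ (Ut_step B hB t a)
  have h := Ut_step B hB (t ++ [a]) a
  have : Ut B (t ++ [a] ++ [a]) = Ut B t := by
    ext f
    simp only [mem_Ut, zt_invol' B hB, zt_invol B hB]
  rwa [this] at h

lemma Ut_eq (B : Matrix (Fin n) (Fin n) ℤ) (hB : TSSS B) (t : List (Fin n)) :
    Ut B t = Ut B [] := by
  induction t using List.reverseRecOn with
  | nil => rfl
  | append_singleton t k ih => rw [Ut_step_eq B hB, ih]

lemma mem_U (B : Matrix (Fin n) (Fin n) ℤ) (hB : TSSS B) (t : List (Fin n)) (f : K n) :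
    f ∈ Ut B [] ↔ f ∈ Lz (zt B t) ∧ ∀ k, f ∈ Lz (zt B (t ++ [k])) := by
  rw [← Ut_eq B hB t, mem_Ut]

lemma pol_eq (B : Matrix (Fin n) (Fin n) ℤ) (hB : TSSS B) (t : List (Fin n)) (k : Fin n) :
    psi (zt B (t ++ [k])) (zt_ne B _) (pol (seed B t).B k) =
      zt B (t ++ [k]) (Sum.inl k) * zt B t (Sum.inl k) := by
  have hw := zt_ne B (t ++ [k])
  have := psi_pol (zt B t) (zt_ne B t) (seed B t).B k (diag0 B hB t k)
    (by rw [← zt_append]; exact hw)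
  simpa only [← zt_append] using this

lemma x_memU (B : Matrix (Fin n) (Fin n) ℤ) (hB : TSSS B) (t : List (Fin n)) (i : Fin n) :
    zt B t (Sum.inl i) ∈ Ut B [] := by
  rw [mem_U B hB t]
  refine ⟨mem_Lz _ _, fun k => ?_⟩
  by_cases hk : i = k
  · subst hk
    have h := pol_eq B hB t i
    have hw := zt_ne B (t ++ [i]) (Sum.inl i)
    have h2 : zt B t (Sum.inl i) = psi (zt B (t ++ [i])) (zt_ne B _) (pol (seed B t).B i) *
        (zt B (t ++ [i]) (Sum.inl i))⁻¹ := by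
      rw [h]; field_simp
    rw [h2]
    exact mul_mem (psi_mem _ _ _) (inv_mem_Lz _ _)
  · have : zt B (t ++ [k]) (Sum.inl i) = zt B t (Sum.inl i) := by
      rw [zt_append, mutz_ne _ _ _ _ (by simpa using hk)]
    rw [← this]; exact mem_Lz _ _

/-- cluster variables as elements of the upper algebra -/
noncomputable def xU (B : Matrix (Fin n) (Fin n) ℤ) (hB : TSSS B) (t : List (Fin n)) (i : Fin n) :
    Ut B [] := ⟨zt B t (Sum.inl i), x_memU B hB t i⟩

/-- existence of the residue map in packaged form -/
lemma exists_Phi (B : Matrix (Fin n) (Fin n) ℤ) (hB : TSSS B) (t : List (Fin n)) (k : Fin n) :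
    ∃ Φ : AddMonoidAlgebra ℤ (I n → ℤ) →+* K n,
      (∀ f, Φ f = 0 ↔ pol (seed B t).B k ∣ f) ∧ (∀ e, Φ (single e 1) ≠ 0) ∧
      Res (psi (zt B (t ++ [k])) (zt_ne B _)) Φ (zt B t (Sum.inl k)) 0 ∧
      ∀ s, s ≠ Sum.inl k → Gd (psi (zt B (t ++ [k])) (zt_ne B _)) Φ (zt B t s) := by
  obtain ⟨d, hd, -⟩ := left_inv' B hB t k
  have hw := zt_ne B (t ++ [k])
  have hinj := zt_inj B hB (t ++ [k])
  have e := zt_append B t k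
  have hw' : ∀ i, mutz (zt B t) (seed B t).B k i ≠ 0 := by rw [← e]; exact hw
  have hinj' : Function.Injective (psi (mutz (zt B t) (seed B t).B k) hw') := by
    simpa only [← e] using hinj
  refine ⟨Ph (zt B t) (seed B t).B k (lin d) hw', fun f => ⟨fun h => ?_, ?_⟩, fun e' => ?_, ?_, ?_⟩
  · exact pol_dvd_of_Ph (zt B t) (seed B t).B k (lin d) hw' hinj' f h
  · rintro ⟨g, rfl⟩
    rw [map_mul, Ph_pol (zt B t) (seed B t).B k (lin d) hd hw', zero_mul]
  · exact PhiR_single_ne _ _ _ _ _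
  · have := res_z (zt B t) (zt_ne B t) (seed B t).B k (diag0 B hB t k) (lin d) hd hw' hinj'
    simpa only [← e] using this
  · intro s hs
    have := gd_z (zt B t) (seed B t).B k (lin d) hw' s hs
    simpa only [← e] using this

lemma psi_w (B : Matrix (Fin n) (Fin n) ℤ) (t : List (Fin n)) (s : I n) :
    psi (zt B t) (zt_ne B _) (single (Pi.single s 1) 1) = zt B t s := by
  rw [psi_single, mon_single]; simp

lemma xU_prime (B : Matrix (Fin n) (Fin n) ℤ) (hB : TSSS B) (t : List (Fin n)) (k : Fin n) :
    Prime (xU B hB t k) := by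
  obtain ⟨Φ, hΦ, hne, -, -⟩ := exists_Phi B hB t k
  have hinj := zt_inj B hB (t ++ [k])
  have hp := pol_eq B hB t k
  have hx := zt_ne B t (Sum.inl k)
  have hw := zt_ne B (t ++ [k]) (Sum.inl k)
  have hψw := psi_w B (t ++ [k]) (Sum.inl k)
  have hΦp : Φ (pol (seed B t).B k) = 0 := (hΦ _).mpr dvd_rfl
  have hrep : ∀ a : Ut B [], ∃ a0, psi (zt B (t ++ [k])) (zt_ne B _) a0 = a := fun a =>
    exists_psi _ _ _ (((mem_U B hB t a).mp a.2).2 k)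
  have hdvd : ∀ (a : Ut B []) a0, psi (zt B (t ++ [k])) (zt_ne B _) a0 = a → Φ a0 = 0 →
      xU B hB t k ∣ a := by
    intro a a0 ha h0
    obtain ⟨a1, rfl⟩ := (hΦ _).mp h0
    rw [map_mul, hp] at ha
    have hq : (a : K n) * (zt B t (Sum.inl k))⁻¹ ∈ Ut B [] := by
      rw [mem_U B hB t]
      have h1 := (mem_U B hB t a).mp a.2
      refine ⟨mul_mem h1.1 (inv_mem_Lz _ _), fun j => ?_⟩
      by_cases hj : k = j
      · subst hj
        have : (a : K n) * (zt B t (Sum.inl k))⁻¹ =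
            zt B (t ++ [k]) (Sum.inl k) * psi (zt B (t ++ [k])) (zt_ne B _) a1 := by
          rw [← ha]; field_simp
        rw [this]
        exact mul_mem (mem_Lz _ _) (psi_mem _ _ _)
      · refine mul_mem (h1.2 j) ?_
        have : zt B (t ++ [j]) (Sum.inl k) = zt B t (Sum.inl k) := by
          rw [zt_append, mutz_ne _ _ _ _ (by simpa using hj)]
        rw [← this]; exact inv_mem_Lz _ _
    refine ⟨⟨_, hq⟩, Subtype.ext ?_⟩
    simp only [xU, Subring.coe_mul]
    field_simp
  refine ⟨?_, ?_, ?_⟩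
  · intro h; exact hx (congrArg Subtype.val h)
  · intro h
    obtain ⟨u, hu⟩ := h.exists_right_inv
    obtain ⟨u0, hu0⟩ := hrep u
    have h1 : zt B t (Sum.inl k) * (u : K n) = 1 := congrArg Subtype.val hu
    have h2 : pol (seed B t).B k * u0 = single (Pi.single (Sum.inl k) 1) 1 := by
      apply hinj
      rw [map_mul, hp, hu0, hψw, mul_assoc, h1, mul_one]
    have h3 := congrArg Φ h2
    rw [map_mul, hΦp, zero_mul] at h3
    exact hne _ h3.symm
  · rintro a b ⟨c, hc⟩
    obtain ⟨a0, ha⟩ := hrep a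
    obtain ⟨b0, hb⟩ := hrep b
    obtain ⟨c0, hc0⟩ := hrep c
    have h1 : (a : K n) * b = zt B t (Sum.inl k) * c := congrArg Subtype.val hc
    have h2 : single (Pi.single (Sum.inl k) 1) 1 * (a0 * b0) = pol (seed B t).B k * c0 := by
      apply hinj
      rw [map_mul, map_mul, map_mul, hψw, hp, ha, hb, hc0, h1]; ring
    have h3 := congrArg Φ h2
    rw [map_mul, map_mul, map_mul, hΦp, zero_mul] at h3
    rcases mul_eq_zero.mp ((mul_eq_zero.mp h3).resolve_left (hne _)) with h | h
    · exact Or.inl (hdvd a a0 ha h)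
    · exact Or.inr (hdvd b b0 hb h)

/-! trivial units -/
lemma triv_unit {ι : Type} [Fintype ι] (g g' : AddMonoidAlgebra ℤ (ι → ℤ)) (h : g * g' = 1) :
    ∃ e c, g = single e c ∧ (c = 1 ∨ c = -1) := by
  have h0 : (1 : AddMonoidAlgebra ℤ (ι → ℤ)) ≠ 0 := one_ne_zero
  have hg : g ≠ 0 := by rintro rfl; rw [zero_mul] at h; exact h0 h.symm
  have hg' : g' ≠ 0 := by rintro rfl; rw [mul_zero] at h; exact h0 h.symm
  have cg : 0 < g.coeff.support.card := by
    rw [Finset.card_pos, Finsupp.support_nonempty_iff]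
    intro h; apply hg; ext e; simp [h]
  have cg' : 0 < g'.coeff.support.card := by
    rw [Finset.card_pos, Finsupp.support_nonempty_iff]
    intro h; apply hg'; ext e; simp [h]
  have hone : ∀ p : (ι → ℤ) × (ι → ℤ), p ∈ g.coeff.support ×ˢ g'.coeff.support →
      UniqueAdd g.coeff.support g'.coeff.support p.1 p.2 →
      p.1 + p.2 = 0 ∧ g.coeff p.1 * g'.coeff p.2 = 1 := by
    intro p hp hu
    have h1 := AddMonoidAlgebra.coeff_mul_add_of_uniqueAdd hu
    rw [Finset.mem_product, Finsupp.mem_support_iff, Finsupp.mem_support_iff] at hp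
    rw [h] at h1
    have h2 : g.coeff p.1 * g'.coeff p.2 ≠ 0 := mul_ne_zero hp.1 hp.2
    rw [← h1] at h2
    have h3 : p.1 + p.2 = 0 := by
      by_contra h3
      apply h2
      rw [AddMonoidAlgebra.one_def]
      simp [Ne.symm h3]
    refine ⟨h3, ?_⟩
    rw [← h1, h3, AddMonoidAlgebra.one_def]; simp
  have hle : g.coeff.support.card * g'.coeff.support.card ≤ 1 := by
    by_contra hlt
    obtain ⟨p, hp, q, hq, hpq, hup, huq⟩ := TwoUniqueSums.uniqueAdd_of_one_lt_card (not_le.mp hlt)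
    have h1 := (hone p hp hup).1
    have h2 := (hone q hq huq).1
    rw [Finset.mem_product] at hq
    have := hup hq.1 hq.2 (h2.trans h1.symm)
    exact hpq (Prod.ext this.1.symm this.2.symm)
  have c1 : g.coeff.support.card = 1 := by nlinarith
  have c2 : g'.coeff.support.card = 1 := by nlinarith
  obtain ⟨e, he⟩ := Finset.card_eq_one.mp c1
  obtain ⟨e', he'⟩ := Finset.card_eq_one.mp c2
  have h1 := (hone (e, e') (by simp [he, he']) (by
    intro x y hx hy _
    rw [he] at hx; rw [he'] at hy
    simpa using And.intro (Finset.mem_singleton.mp hx) (Finset.mem_singleton.mp hy))).2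
  refine ⟨e, g.coeff e, ?_, Int.eq_one_or_neg_one_of_mul_eq_one h1⟩
  ext x
  by_cases hx : x = e
  · subst hx; simp
  · have : x ∉ g.coeff.support := by rw [he]; simpa using hx
    rw [Finsupp.notMem_support_iff] at this
    simp [this, Ne.symm hx]

lemma exp_nonpos {A F Q : Type*} [CommRing A] [Field F] [Field Q] {ψ : A →+* F} {Φ : A →+* Q}
    (hψ : Function.Injective ψ) {ι : Type} [Fintype ι] (z : ι → F) (hz : ∀ i, z i ≠ 0) (s : ι)
    (hs : Res ψ Φ (z s) 0) (ho : ∀ i, i ≠ s → Gd ψ Φ (z i)) (e : ι → ℤ) (c : ℤ)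
    (h : Gd ψ Φ (c * mon z e)) : e s ≤ 0 := by
  by_contra hlt
  obtain ⟨m, hm⟩ : ∃ m : ℕ, e s = m + 1 := ⟨(e s - 1).toNat, by omega⟩
  have e1 : mon z e = z s ^ (m+1) * mon z (e - Pi.single s (e s)) := by
    have : z s ^ (m+1) = mon z (Pi.single s (e s)) := by
      rw [mon_single, hm]; norm_cast
    rw [this, ← mon_add z hz]; congr 1; abel
  have g1 : Gd ψ Φ (mon z (e - Pi.single s (e s))) := by
    refine Gd.prod _ _ fun i _ => ?_
    by_cases hi : i = s
    · subst hi; simpa using Gd.one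
    · exact (ho i hi).zpow hψ _
  obtain ⟨d, -, hd⟩ := g1
  have r := (Res.int c).mul ((hs.pow (m+1)).mul hd)
  rw [← e1] at r
  obtain ⟨r', hr', h'⟩ := h
  have := h'.unique hψ r
  simp at this
  exact hr' this

lemma inv_form {ι : Type} [Fintype ι] {F : Type*} [Field F] (z : ι → F) (e : ι → ℤ) (c : ℤ)
    (hc : c = 1 ∨ c = -1) : ((c : F) * mon z e)⁻¹ = c * mon z (-e) := by
  rw [mon_neg, mul_inv]
  rcases hc with rfl | rfl <;> simp [inv_neg]

lemma assoc_eq (B : Matrix (Fin n) (Fin n) ℤ) (hB : TSSS B) (t t' : List (Fin n)) (i j : Fin n)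
    (h : Associated (xU B hB t i) (xU B hB t' j)) : zt B t (Sum.inl i) = zt B t' (Sum.inl j) := by
  obtain ⟨u, hu⟩ := h
  have hu' : zt B t (Sum.inl i) * ((u : Ut B []) : K n) = zt B t' (Sum.inl j) :=
    congrArg Subtype.val hu
  have huu : ((u : Ut B []) : K n) * ((u⁻¹ : (Ut B [])ˣ) : Ut B []) = 1 :=
    congrArg Subtype.val (Units.mul_inv u)
  have hmu := (mem_U B hB [] _).mp (u : Ut B []).2
  have hmv := (mem_U B hB [] _).mp ((u⁻¹ : (Ut B [])ˣ) : Ut B []).2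
  generalize ((u : Ut B []) : K n) = v at hu' huu hmu
  generalize (((u⁻¹ : (Ut B [])ˣ) : Ut B []) : K n) = v' at huu hmv
  have hv0 : v ≠ 0 := left_ne_zero_of_mul_eq_one huu
  have hv' : v' = v⁻¹ := (inv_eq_of_mul_eq_one_right huu).symm
  subst hv'
  obtain ⟨g, hg⟩ := exists_psi _ (zt_ne B []) _ hmu.1
  obtain ⟨g', hg'⟩ := exists_psi _ (zt_ne B []) _ hmv.1
  obtain ⟨e, c, rfl, hc⟩ := triv_unit g g' (by
    apply zt_inj B hB []
    rw [map_mul, hg, hg', huu, map_one])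
  rw [psi_single] at hg
  have hgi : v⁻¹ = c * mon (zt B []) (-e) := by rw [← hg, inv_form _ _ _ hc]
  have hk : ∀ k, e (Sum.inl k) = 0 := by
    intro k
    obtain ⟨Φ, -, -, hr, ho⟩ := exists_Phi B hB [] k
    have hinj := zt_inj B hB ([] ++ [k])
    obtain ⟨a, ha⟩ := exists_psi _ (zt_ne B ([] ++ [k])) _ (hmu.2 k)
    obtain ⟨b, hb⟩ := exists_psi _ (zt_ne B ([] ++ [k])) _ (hmv.2 k)
    have hab : a * b = 1 := by apply hinj; rw [map_mul, ha, hb, huu, map_one]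
    have hab' := congrArg Φ hab
    rw [map_mul, map_one] at hab'
    have g1 : Gd (psi (zt B ([] ++ [k])) (zt_ne B _)) Φ v :=
      ⟨Φ a, left_ne_zero_of_mul_eq_one hab', ha ▸ Res.of a⟩
    have g2 := g1.inv hinj
    rw [← hg] at g1
    rw [hgi] at g2
    have l1 := exp_nonpos hinj _ (zt_ne B []) _ hr ho _ _ g1
    have l2 := exp_nonpos hinj _ (zt_ne B []) _ hr ho _ _ g2
    simp at l2
    omega
  have hx := zt_ne B t (Sum.inl i)
  have hveq : v = zt B t' (Sum.inl j) * (zt B t (Sum.inl i))⁻¹ := by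
    rw [← hu']; field_simp
  have hpos : ∀ m : Fin n, ∃ r, 0 < r ∧ RP m v r := by
    intro m
    obtain ⟨r, hr, h1⟩ := zt_pos B t m (Sum.inl i) (by simp)
    obtain ⟨r', hr', h2⟩ := zt_pos B t' m (Sum.inl j) (by simp)
    rw [hveq]
    exact ⟨r' * r⁻¹, by positivity, h2.mul (h1.inv alg_inj hr.ne')⟩
  have hy : ∀ m, e (Sum.inr m) = 0 := by
    intro m
    obtain ⟨r, hr, h1⟩ := hpos m
    have hs : RP m (zt B [] (Sum.inr m)) 0 := by
      have := RP_gen m (Sum.inr m)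
      have h0 : pt m (Sum.inr m) = 0 := by simp [pt]
      rw [h0] at this
      exact this
    have ho : ∀ s, s ≠ Sum.inr m → Gd (algebraMap (MvPolynomial (I n) ℚ) (K n))
        (MvPolynomial.eval (pt m)) (zt B [] s) := by
      intro s hs
      obtain ⟨c, hc, h⟩ := zt_pos B [] m s hs
      exact ⟨c, hc.ne', h⟩
    have g1 : Gd (algebraMap (MvPolynomial (I n) ℚ) (K n)) (MvPolynomial.eval (pt m)) v :=
      ⟨r, hr.ne', h1⟩
    have g2 := g1.inv alg_inj
    rw [← hg] at g1
    rw [hgi] at g2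
    have l1 := exp_nonpos alg_inj _ (zt_ne B []) _ hs ho _ _ g1
    have l2 := exp_nonpos alg_inj _ (zt_ne B []) _ hs ho _ _ g2
    simp at l2
    omega
  have he : e = 0 := by
    funext s
    rcases s with s | s
    · exact hk s
    · exact hy s
  subst he
  rw [mon_zero, mul_one] at hg
  rcases hc with rfl | rfl
  · rw [← hu', ← hg]; simp
  · exfalso
    obtain ⟨r, hr, h1⟩ := hpos i
    rw [← hg] at h1
    have := h1.unique alg_inj (Res.int (-1))
    rw [this] at hr
    norm_num at hr

lemma match_pos (B : Matrix (Fin n) (Fin n) ℤ) (hB : TSSS B) (t t' : List (Fin n))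
    (α β : Fin n → ℤ)
    (heq : ∏ i, zt B t (Sum.inl i) ^ α i = ∏ i, zt B t' (Sum.inl i) ^ β i) (i : Fin n)
    (hi : 0 < α i) : ∃ j, zt B t (Sum.inl i) = zt B t' (Sum.inl j) := by
  have hsplit : ∀ (t : List (Fin n)) (γ : Fin n → ℤ), ∏ i, zt B t (Sum.inl i) ^ γ i =
      (∏ i, zt B t (Sum.inl i) ^ (γ i).toNat) / ∏ i, zt B t (Sum.inl i) ^ (-γ i).toNat := by
    intro t γ
    rw [← Finset.prod_div_distrib]
    refine Finset.prod_congr rfl fun i _ => ?_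
    rw [← zpow_natCast, ← zpow_natCast, ← zpow_sub₀ (zt_ne B t _)]
    congr 1; omega
  have hn0 : ∀ (t : List (Fin n)) (γ : Fin n → ℤ), ∏ i, zt B t (Sum.inl i) ^ (-γ i).toNat ≠ 0 :=
    fun t γ => Finset.prod_ne_zero_iff.mpr fun i _ => pow_ne_zero _ (zt_ne B t _)
  rw [hsplit, hsplit, div_eq_div_iff (hn0 _ _) (hn0 _ _)] at heq
  have heqU : (∏ i, xU B hB t i ^ (α i).toNat) * (∏ i, xU B hB t' i ^ (-β i).toNat) =
      (∏ i, xU B hB t' i ^ (β i).toNat) * ∏ i, xU B hB t i ^ (-α i).toNat := by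
    apply Subtype.ext
    push_cast
    exact heq
  have hpr := xU_prime B hB t i
  have hd : xU B hB t i ∣ (∏ i, xU B hB t' i ^ (β i).toNat) * ∏ i, xU B hB t i ^ (-α i).toNat := by
    rw [← heqU]
    refine Dvd.dvd.mul_right ?_ _
    refine dvd_trans (dvd_pow_self _ (by omega : (α i).toNat ≠ 0)) ?_
    exact Finset.dvd_prod_of_mem (fun i => xU B hB t i ^ (α i).toNat) (Finset.mem_univ i)
  rcases hpr.dvd_or_dvd hd with h | h
  · obtain ⟨j, -, hj⟩ := (Prime.dvd_finsetProd_iff hpr _).mp h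
    refine ⟨j, assoc_eq B hB t t' i j ?_⟩
    exact (hpr.dvd_prime_iff_associated (xU_prime B hB t' j)).mp (hpr.dvd_of_dvd_pow hj)
  · exfalso
    obtain ⟨j, -, hj⟩ := (Prime.dvd_finsetProd_iff hpr _).mp h
    have := assoc_eq B hB t t i j
      ((hpr.dvd_prime_iff_associated (xU_prime B hB t j)).mp (hpr.dvd_of_dvd_pow hj))
    have hij : i = j := Sum.inl_injective ((zt_algind B hB t).injective this)
    subst hij
    have : (-α i).toNat = 0 := by omega
    rw [this, pow_zero] at hj
    exact hpr.not_dvd_one hj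

lemma match_ne (B : Matrix (Fin n) (Fin n) ℤ) (hB : TSSS B) (t t' : List (Fin n))
    (α β : Fin n → ℤ)
    (heq : ∏ i, zt B t (Sum.inl i) ^ α i = ∏ i, zt B t' (Sum.inl i) ^ β i) (i : Fin n)
    (hi : α i ≠ 0) : ∃ j, zt B t (Sum.inl i) = zt B t' (Sum.inl j) := by
  rcases lt_or_gt_of_ne hi with h | h
  · refine match_pos B hB t t' (-α) (-β) ?_ i (by simpa using h)
    simp only [Pi.neg_apply, zpow_neg, Finset.prod_inv_distrib, heq]
  · exact match_pos B hB t t' α β heq i h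

lemma final (B : Matrix (Fin n) (Fin n) ℤ) (hB : TSSS B) (t t' : List (Fin n))
    (α β : Fin n → ℤ)
    (heq : ∏ i, zt B t (Sum.inl i) ^ α i = ∏ i, zt B t' (Sum.inl i) ^ β i) :
    ∃ σ : Equiv.Perm (Fin n), ∀ i, α i ≠ 0 →
      zt B t (Sum.inl i) = zt B t' (Sum.inl (σ i)) ∧ α i = β (σ i) := by
  have hm := match_ne B hB t t' α β heq
  let f : Fin n → Fin n := fun i => if h : α i ≠ 0 then (hm i h).choose else i
  have hf : ∀ i, α i ≠ 0 → zt B t (Sum.inl i) = zt B t' (Sum.inl (f i)) := by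
    intro i h
    simp only [f, dif_pos h]
    exact (hm i h).choose_spec
  obtain ⟨g, hg⟩ := Finset.exists_equiv_extend_of_card_eq (α := Fin n) (β := Fin n)
    (t := Finset.univ) (by simp) (s := Finset.univ.filter fun i => α i ≠ 0) (f := f)
    (Finset.subset_univ _) (by
      intro i hi j hj hij
      simp only [Finset.coe_filter, Finset.mem_univ, true_and, Set.mem_ofPred_eq] at hi hj
      have h1 := hf i hi
      have h2 := hf j hj
      rw [hij, ← h2] at h1
      exact Sum.inl_injective ((zt_algind B hB t).injective h1))
  let σ : Equiv.Perm (Fin n) := g.trans (Equiv.subtypeUnivEquiv (by simp))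
  have hσ : ∀ i, α i ≠ 0 → zt B t (Sum.inl i) = zt B t' (Sum.inl (σ i)) := by
    intro i hi
    have : σ i = f i := hg i (by simp [hi])
    rw [this]; exact hf i hi
  refine ⟨σ, fun i hi => ⟨hσ i hi, ?_⟩⟩
  have hmon : ∀ γ : Fin n → ℤ, mon (zt B t') (Sum.elim γ 0) = ∏ i, zt B t' (Sum.inl i) ^ γ i := by
    intro γ; simp [mon, Fintype.prod_sum_type]
  have e1 : ∏ i, zt B t (Sum.inl i) ^ α i = mon (zt B t') (Sum.elim (fun j => α (σ.symm j)) 0) := by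
    rw [hmon, ← Equiv.prod_comp σ (fun j => zt B t' (Sum.inl j) ^ α (σ.symm j))]
    refine Finset.prod_congr rfl fun i _ => ?_
    rw [Equiv.symm_apply_apply]
    by_cases h : α i = 0
    · simp [h]
    · rw [hσ i h]
  rw [e1, ← hmon] at heq
  have h2 : (single (Sum.elim (fun j => α (σ.symm j)) 0) 1 : AddMonoidAlgebra ℤ (I n → ℤ)) =
      single (Sum.elim β 0) 1 := by
    apply zt_inj B hB t'
    rw [psi_single, psi_single, heq]
  have h3 := (AddMonoidAlgebra.single_left_injective (one_ne_zero)) h2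
  have := congrFun h3 (Sum.inl (σ i))
  simpa using this

end upper
end CA

namespace CA

/-- Corollary `cluster laurent monomial`.
Let `𝒜` be a TSSS cluster algebra having principal coefficients, `t, t' ∈ 𝕋ₙ`, and
`α, β ∈ ℤⁿ` nonzero.  If `X_t^α = X_{t'}^β` then there is a permutation `σ` of `[1,n]`
such that `x_{i;t} = x_{σ(i);t'}` and `αᵢ = β_{σ(i)}` for every `i` with `αᵢ ≠ 0`. -/
theorem statement14 {n : ℕ} (B : Matrix (Fin n) (Fin n) ℤ) (hB : TSSS B)
    (t t' : List (Fin n)) (α β : Fin n → ℤ) (hα : α ≠ 0) (hβ : β ≠ 0)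
    (heq : (∏ i, (seed B t).x i ^ α i) = ∏ i, (seed B t').x i ^ β i) :
    ∃ σ : Equiv.Perm (Fin n), ∀ i, α i ≠ 0 →
      (seed B t).x i = (seed B t').x (σ i) ∧ α i = β (σ i) := by
  exact final B hB t t' α β heq

end CA
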